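/- arXiv:2306.07811 — 4 statements merged into one kernel-verified Lean document; each statement's English description precedes it below -/
import Mathlib

section
/- For every normalized finite Rademacher sum X = Σ_{i=1}^n a_i ε_i, one has P(|X| ≥ 2/√6) ≥ 1/4. -/
/-- The probability that a finite Rademacher sum with weights `a` (signs chosen
independently and uniformly from `{-1,+1}`) satisfies the predicate `p`. -/
noncomputable def radProb {ι : Type*} [Fintype ι] (a : ι → ℝ) (p : ℝ → Prop) : ℝ :=
  (Nat.card {ε : ι → Bool | p (∑ i, a i * (if ε i then (1 : ℝ) else -1))}) /
    2 ^ (Fintype.card ι)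

/-- The expectation of `g (∑ εᵢ aᵢ)` over independent uniform signs `εᵢ`, for a list of weights. -/
noncomputable def signAvg : List ℝ → (ℝ → ℝ) → ℝ
  | [], g => g 0
  | a :: l, g => (signAvg l (fun y => g (a + y)) + signAvg l (fun y => g (-a + y))) / 2

namespace signAvg

theorem mono (l : List ℝ) {g h : ℝ → ℝ} (H : ∀ y, g y ≤ h y) : signAvg l g ≤ signAvg l h := by
  induction l generalizing g h with
  | nil => exact H 0
  | cons a l ih =>
    have h1 := ih (fun y => H (a + y))
    have h2 := ih (fun y => H (-a + y))
    simp only [signAvg]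
    linarith

theorem add (l : List ℝ) (g h : ℝ → ℝ) :
    signAvg l (fun y => g y + h y) = signAvg l g + signAvg l h := by
  induction l generalizing g h with
  | nil => rfl
  | cons a l ih =>
    simp only [signAvg, ih (fun y => g (a + y)), ih (fun y => g (-a + y))]
    ring

theorem const_mul (l : List ℝ) (c : ℝ) (g : ℝ → ℝ) :
    signAvg l (fun y => c * g y) = c * signAvg l g := by
  induction l generalizing g with
  | nil => rfl
  | cons a l ih =>
    simp only [signAvg, ih (fun y => g (a + y)), ih (fun y => g (-a + y))]
    ring

theorem const (l : List ℝ) (c : ℝ) : signAvg l (fun _ => c) = c := by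
  induction l with
  | nil => rfl
  | cons a l ih => simp only [signAvg, ih]; ring

theorem comp_neg (l : List ℝ) (g : ℝ → ℝ) : signAvg l (fun y => g (-y)) = signAvg l g := by
  induction l generalizing g with
  | nil => simp [signAvg]
  | cons a l ih =>
    simp only [signAvg]
    rw [← ih (fun y => g (a + y)), ← ih (fun y => g (-a + y)), add_comm]
    simp only [neg_add_rev, neg_neg]
    congr 3 <;> (funext y; congr 1; ring)

theorem cons_abs (a : ℝ) (l : List ℝ) (g : ℝ → ℝ) :
    signAvg (|a| :: l) g = signAvg (a :: l) g := by
  rcases abs_cases a with ⟨h, -⟩ | ⟨h, -⟩ <;> rw [h]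
  simp only [signAvg, neg_neg, add_comm]

theorem map_abs (l : List ℝ) (g : ℝ → ℝ) : signAvg (l.map abs) g = signAvg l g := by
  induction l generalizing g with
  | nil => rfl
  | cons a l ih =>
    rw [List.map_cons, cons_abs]
    simp only [signAvg, ih]

theorem perm {l l' : List ℝ} (h : l.Perm l') (g : ℝ → ℝ) : signAvg l g = signAvg l' g := by
  induction h generalizing g with
  | nil => rfl
  | cons a _ ih => simp only [signAvg, ih]
  | swap a b l =>
    simp only [signAvg, add_left_comm a, add_left_comm (-a)]
    ring
  | trans _ _ ih₁ ih₂ => exact (ih₁ g).trans (ih₂ g)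

theorem append (l l' : List ℝ) (g : ℝ → ℝ) :
    signAvg (l ++ l') g = signAvg l' (fun y => signAvg l (fun z => g (z + y))) := by
  induction l generalizing g with
  | nil => simp [signAvg]
  | cons a l ih =>
    simp only [List.cons_append, signAvg, ih, div_eq_inv_mul, const_mul, add, add_assoc]

theorem replicate_zero (k : ℕ) (g : ℝ → ℝ) : signAvg (List.replicate k 0) g = g 0 := by
  induction k generalizing g with
  | zero => rfl
  | succ k ih => simp [List.replicate_succ, signAvg, ih]

/-- The second moment of a Rademacher sum. -/
theorem sq (l : List ℝ) : signAvg l (fun y => y ^ 2) = (l.map (· ^ 2)).sum := by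
  have key : ∀ (l : List ℝ) (c : ℝ),
      signAvg l (fun y => (c + y) ^ 2) = c ^ 2 + (l.map (· ^ 2)).sum := by
    intro l
    induction l with
    | nil => intro c; simp [signAvg]
    | cons a l ih =>
      intro c
      simp only [signAvg, ← add_assoc, ih, List.map_cons, List.sum_cons]
      ring
  simpa using key l 0

/-- The fourth moment of a Rademacher sum is at most that of a Gaussian. -/
theorem pow_four_le (l : List ℝ) :
    signAvg l (fun y => y ^ 4) ≤ 3 * (l.map (· ^ 2)).sum ^ 2 := by
  induction l with
  | nil => simp [signAvg]
  | cons a l ih =>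
    have h : signAvg (a :: l) (fun y => y ^ 4)
        = a ^ 4 + 6 * a ^ 2 * signAvg l (fun y => y ^ 2) + signAvg l (fun y => y ^ 4) := by
      rw [← const_mul, ← const l (a ^ 4), ← add, ← add]
      simp only [signAvg]
      rw [← add, div_eq_inv_mul, ← const_mul]
      congr 1; funext y; ring
    rw [h, sq, List.map_cons, List.sum_cons]
    nlinarith [sq_nonneg (a ^ 2)]

/-- The characteristic function of a Rademacher sum. -/
theorem cos_mul (l : List ℝ) (s : ℝ) :
    signAvg l (fun y => Real.cos (s * y)) = (l.map fun a => Real.cos (s * a)).prod := by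
  have key : ∀ (l : List ℝ) (c : ℝ), signAvg l (fun y => Real.cos (s * (c + y)))
      = Real.cos (s * c) * (l.map fun a => Real.cos (s * a)).prod := by
    intro l
    induction l with
    | nil => intro c; simp [signAvg]
    | cons a l ih =>
      intro c
      simp only [signAvg, ← add_assoc, ih, List.map_cons, List.prod_cons]
      rw [mul_add, mul_add, mul_neg, Real.cos_add, Real.cos_add, Real.cos_neg, Real.sin_neg]
      ring
  simpa using key l 0

end signAvg

open Classical in
theorem radProb_eq_signAvg {n : ℕ} (a : Fin n → ℝ) (p : ℝ → Prop) :
    radProb a p = signAvg (List.ofFn a) (fun y => if p y then 1 else 0) := by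
  induction n generalizing p with
  | zero =>
    have : Nat.card {ε : Fin 0 → Bool | p 0} = if p 0 then 1 else 0 := by
      by_cases h : p 0 <;> simp [h]
    simp only [radProb, Finset.univ_eq_empty, Finset.sum_empty, this, Fintype.card_fin, pow_zero,
      div_one, List.ofFn_zero, signAvg]
    split_ifs <;> simp
  | succ n ih =>
    have hs : ∀ (b : Bool) (q : ℝ → Prop), (∀ y, q y ↔ p (a 0 * (if b then (1 : ℝ) else -1) + y)) →
        Nat.card {ε : Fin n → Bool | q (∑ i, a i.succ * (if ε i then (1 : ℝ) else -1))}
          = (Finset.univ.filter fun ε : Fin n → Bool =>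
              p (∑ i, a i * (if (Fin.cons b ε : Fin (n + 1) → Bool) i then (1 : ℝ) else -1))).card
        := by
      intro b q hq
      rw [Nat.card_eq_fintype_card, Fintype.card_ofFinset]
      congr 1; ext ε
      simp [Fin.sum_univ_succ, hq]
    have e1 := ih (fun i => a i.succ) (fun y => p (a 0 + y))
    have e2 := ih (fun i => a i.succ) (fun y => p (-a 0 + y))
    rw [List.ofFn_succ, signAvg, ← e1, ← e2]
    simp only [radProb, Fintype.card_fin]
    rw [hs true (fun y => p (a 0 + y)) (fun y => by simp),
      hs false (fun y => p (-a 0 + y)) (fun y => by simp)]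
    have : Nat.card {ε : Fin (n + 1) → Bool | p (∑ i, a i * (if ε i then (1 : ℝ) else -1))}
        = (Finset.univ.filter fun ε : Fin (n + 1) → Bool =>
              p (∑ i, a i * (if ε i then (1 : ℝ) else -1))).card := by
      rw [Nat.card_eq_fintype_card, Fintype.card_ofFinset]
      congr 1
    rw [this, Finset.card_filter, Finset.card_filter, Finset.card_filter]
    rw [← (Fin.consEquiv (fun _ : Fin (n + 1) => Bool)).sum_comp, Fintype.sum_prod_type,
      Fintype.sum_bool]
    simp only [Fin.consEquiv_apply]
    push_cast
    rw [pow_succ]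
    field_simp

/-- The indicator of `|z| < t`. -/
noncomputable def inside (t z : ℝ) : ℝ := if |z| < t then 1 else 0

/-- The indicator of `τ ≤ |z|`. -/
noncomputable def atLeast (τ z : ℝ) : ℝ := if τ ≤ |z| then 1 else 0

theorem inside_le_one (t z : ℝ) : inside t z ≤ 1 := by
  unfold inside; split_ifs <;> norm_num

theorem inside_neg (t z : ℝ) : inside t (-z) = inside t z := by simp [inside]

theorem atLeast_nonneg (τ z : ℝ) : 0 ≤ atLeast τ z := by
  unfold atLeast; split_ifs <;> norm_num

theorem atLeast_neg (τ z : ℝ) : atLeast τ (-z) = atLeast τ z := by simp [atLeast]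

theorem atLeast_of_nonpos {τ : ℝ} (h : τ ≤ 0) : atLeast τ = fun _ => 1 := by
  funext z; exact if_pos (h.trans (abs_nonneg z))

theorem atLeast_eq_one_sub_inside (t z : ℝ) : atLeast t z = 1 - inside t z := by
  unfold atLeast inside
  by_cases h : |z| < t
  · simp [h, h.not_ge]
  · simp [h, not_lt.1 h]

theorem inside_add_le_one {t x y : ℝ} (h : x + 2 * t ≤ y) : inside t x + inside t y ≤ 1 := by
  unfold inside
  split_ifs with hx hy <;> try norm_num
  linarith [(abs_lt.1 hx).1, (abs_lt.1 hy).2]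

theorem inside_add_add_le_one {t x y z : ℝ} (h : x + 2 * t ≤ y) (h' : y + 2 * t ≤ z)
    (ht : 0 ≤ t) : inside t x + inside t y + inside t z ≤ 1 := by
  have h1 := inside_add_le_one h
  have h2 := inside_add_le_one h'
  have h3 := inside_add_le_one (show x + 2 * t ≤ z by linarith)
  unfold inside at *
  split_ifs at * <;> linarith

theorem inside_le_one_sub_atLeast {t s ρ : ℝ} (hρ : 0 ≤ ρ) :
    inside t (s + ρ) ≤ 1 - atLeast (t - s) ρ := by
  unfold inside atLeast
  rw [abs_of_nonneg hρ]
  split_ifs with h1 h2 <;> try norm_num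
  linarith [(abs_lt.1 h1).2]

theorem signAvg.quarter_le_of_le_add (a b t : ℝ) (l : List ℝ) (h : t ≤ a + b) :
    1 / 4 ≤ signAvg (a :: b :: l) (atLeast t) := by
  have key : ∀ y, (1 : ℝ) ≤ atLeast t (a + (b + y)) + atLeast t (-a + (-b + y)) := by
    intro y
    rcases le_total 0 y with hy | hy
    · have : atLeast t (a + (b + y)) = 1 := if_pos (le_abs.2 (Or.inl (by linarith)))
      linarith [atLeast_nonneg t (-a + (-b + y))]
    · have : atLeast t (-a + (-b + y)) = 1 := if_pos (le_abs.2 (Or.inr (by linarith)))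
      linarith [atLeast_nonneg t (a + (b + y))]
  have h1 := signAvg.mono l key
  rw [signAvg.const, signAvg.add] at h1
  have h2 := signAvg.mono l (fun y => atLeast_nonneg t (a + (-b + y)))
  have h3 := signAvg.mono l (fun y => atLeast_nonneg t (-a + (b + y)))
  rw [signAvg.const] at h2 h3
  simp only [signAvg]
  linarith

/-- A linearized Paley–Zygmund inequality for Rademacher sums. -/
theorem signAvg.atLeast_ge (l : List ℝ) (τ : ℝ) {v : ℝ} (hv : 0 < v)
    (hl : (l.map (· ^ 2)).sum = v) :
    1 / 3 - 2 / 3 * (τ ^ 2 / v) ≤ signAvg l (atLeast τ) := by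
  have key : ∀ y, (-(2 * τ ^ 2 / (3 * v)) - τ ^ 4 / (9 * v ^ 2))
      + ((2 / (3 * v) + 2 * τ ^ 2 / (9 * v ^ 2)) * y ^ 2 + -(1 / (9 * v ^ 2)) * y ^ 4)
      ≤ atLeast τ y := by
    intro y
    have e : (-(2 * τ ^ 2 / (3 * v)) - τ ^ 4 / (9 * v ^ 2))
      + ((2 / (3 * v) + 2 * τ ^ 2 / (9 * v ^ 2)) * y ^ 2 + -(1 / (9 * v ^ 2)) * y ^ 4)
      = 1 - (1 - (y ^ 2 - τ ^ 2) / (3 * v)) ^ 2 := by field_simp; ring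
    rw [e]
    by_cases hy : τ ≤ |y|
    · rw [atLeast, if_pos hy]
      linarith [sq_nonneg (1 - (y ^ 2 - τ ^ 2) / (3 * v))]
    · rw [atLeast, if_neg hy]
      push Not at hy
      have : y ^ 2 ≤ τ ^ 2 := sq_le_sq' (by linarith [neg_abs_le y]) (by linarith [le_abs_self y])
      have : (y ^ 2 - τ ^ 2) / (3 * v) ≤ 0 :=
        div_nonpos_of_nonpos_of_nonneg (by linarith) (by linarith)
      nlinarith
  have h := signAvg.mono l key
  rw [signAvg.add, signAvg.add, signAvg.const, signAvg.const_mul, signAvg.const_mul,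
    signAvg.sq, hl] at h
  have h4 := signAvg.pow_four_le l
  rw [hl] at h4
  by_cases hz : τ ^ 2 / v ≤ 2
  · refine le_trans ?_ h
    have h5 : -(1 / 3 : ℝ) ≤ -(1 / (9 * v ^ 2)) * signAvg l (fun y => y ^ 4) := by
      rw [neg_mul, neg_le_neg_iff, one_div, inv_mul_le_iff₀ (by positivity)]
      linarith
    have h6 : (-(2 * τ ^ 2 / (3 * v)) - τ ^ 4 / (9 * v ^ 2))
        + (2 / (3 * v) + 2 * τ ^ 2 / (9 * v ^ 2)) * v
        = 2 / 3 - 4 / 9 * (τ ^ 2 / v) - 1 / 9 * (τ ^ 2 / v) ^ 2 := by field_simp; ring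
    have : 0 ≤ τ ^ 2 / v := by positivity
    nlinarith
  · have h0 := signAvg.mono l (fun y => atLeast_nonneg τ y)
    rw [signAvg.const] at h0
    have : signAvg l (fun y => atLeast τ y) = signAvg l (atLeast τ) := rfl
    linarith

set_option maxHeartbeats 1000000 in
/-- A chain decomposition of the sign patterns of six weights, any three of which have sum at
least `t`, bounds the number of patterns that put the shifted sum into `(-t, t)`. -/
theorem signAvg.inside_le_of_chains {a b c d e f t : ℝ} (h1 : b ≤ a) (h2 : c ≤ b)
    (h3 : d ≤ c) (h4 : e ≤ d) (h5 : f ≤ e) (h : t ≤ d + e + f) (ht : 0 ≤ t) (ρ : ℝ) :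
    signAvg [a, b, c, d, e, f] (fun z => inside t (z + ρ)) ≤ (50 - (
      atLeast (t - (a + b + c + f - d - e)) ρ +
      atLeast (t - (a + b + c + e - d - f)) ρ +
      atLeast (t - (a + b + c + d - e - f)) ρ +
      atLeast (t - (a + c + e + f - b - d)) ρ +
      atLeast (t - (a + c + d + f - b - e)) ρ +
      atLeast (t - (a + c + d + e - b - f)) ρ +
      atLeast (t - (a + b + e + f - c - d)) ρ +
      atLeast (t - (a + b + d + f - c - e)) ρ +
      atLeast (t - (a + b + d + e - c - f)) ρ)) / 64 := by
  wlog hρ : 0 ≤ ρ generalizing ρ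
  · have := this (-ρ) (by linarith)
    simp only [atLeast_neg] at this
    rw [← signAvg.comp_neg] at this
    simpa only [← neg_add, inside_neg] using this
  let F : ℝ → ℝ → ℝ → ℝ → ℝ → ℝ → ℝ :=
    fun u v w x y z => inside t (u + (v + (w + (x + (y + (z + 0))))) + ρ)
  have F_le_one : ∀ u v w x y z, F u v w x y z ≤ 1 := fun _ _ _ _ _ _ => inside_le_one _ _
  have pair : ∀ u v w x y z u' v' w' x' y' z',
      u + v + w + x + y + z + 2 * t ≤ u' + v' + w' + x' + y' + z' →
      F u v w x y z + F u' v' w' x' y' z' ≤ 1 :=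
    fun _ _ _ _ _ _ _ _ _ _ _ _ H => inside_add_le_one (by linarith)
  have triple : F (-a) (-b) (-c) (-d) (-e) (-f) + F a b c (-d) (-e) (-f) + F a b c d e f ≤ 1 :=
    inside_add_add_le_one (by linarith) (by linarith) ht
  have four : ∀ u v w x y z s, u + v + w + x + y + z = s →
      F u v w x y z ≤ 1 - atLeast (t - s) ρ := by
    rintro u v w x y z s rfl
    convert inside_le_one_sub_atLeast (t := t) (s := u + v + w + x + y + z) hρ using 2
    ring
  have expand : signAvg [a, b, c, d, e, f] (fun z => inside t (z + ρ)) =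
      ((((((F a b c d e f + F a b c d e (-f)) +
      (F a b c d (-e) f + F a b c d (-e) (-f))) +
      ((F a b c (-d) e f + F a b c (-d) e (-f)) +
      (F a b c (-d) (-e) f + F a b c (-d) (-e) (-f)))) +
      (((F a b (-c) d e f + F a b (-c) d e (-f)) +
      (F a b (-c) d (-e) f + F a b (-c) d (-e) (-f))) +
      ((F a b (-c) (-d) e f + F a b (-c) (-d) e (-f)) +
      (F a b (-c) (-d) (-e) f + F a b (-c) (-d) (-e) (-f))))) +
      ((((F a (-b) c d e f + F a (-b) c d e (-f)) +
      (F a (-b) c d (-e) f + F a (-b) c d (-e) (-f))) +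
      ((F a (-b) c (-d) e f + F a (-b) c (-d) e (-f)) +
      (F a (-b) c (-d) (-e) f + F a (-b) c (-d) (-e) (-f)))) +
      (((F a (-b) (-c) d e f + F a (-b) (-c) d e (-f)) +
      (F a (-b) (-c) d (-e) f + F a (-b) (-c) d (-e) (-f))) +
      ((F a (-b) (-c) (-d) e f + F a (-b) (-c) (-d) e (-f)) +
      (F a (-b) (-c) (-d) (-e) f + F a (-b) (-c) (-d) (-e) (-f)))))) +
      (((((F (-a) b c d e f + F (-a) b c d e (-f)) +
      (F (-a) b c d (-e) f + F (-a) b c d (-e) (-f))) +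
      ((F (-a) b c (-d) e f + F (-a) b c (-d) e (-f)) +
      (F (-a) b c (-d) (-e) f + F (-a) b c (-d) (-e) (-f)))) +
      (((F (-a) b (-c) d e f + F (-a) b (-c) d e (-f)) +
      (F (-a) b (-c) d (-e) f + F (-a) b (-c) d (-e) (-f))) +
      ((F (-a) b (-c) (-d) e f + F (-a) b (-c) (-d) e (-f)) +
      (F (-a) b (-c) (-d) (-e) f + F (-a) b (-c) (-d) (-e) (-f))))) +
      ((((F (-a) (-b) c d e f + F (-a) (-b) c d e (-f)) +
      (F (-a) (-b) c d (-e) f + F (-a) (-b) c d (-e) (-f))) +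
      ((F (-a) (-b) c (-d) e f + F (-a) (-b) c (-d) e (-f)) +
      (F (-a) (-b) c (-d) (-e) f + F (-a) (-b) c (-d) (-e) (-f)))) +
      (((F (-a) (-b) (-c) d e f + F (-a) (-b) (-c) d e (-f)) +
      (F (-a) (-b) (-c) d (-e) f + F (-a) (-b) (-c) d (-e) (-f))) +
      ((F (-a) (-b) (-c) (-d) e f + F (-a) (-b) (-c) (-d) e (-f)) +
      (F (-a) (-b) (-c) (-d) (-e) f + F (-a) (-b) (-c) (-d) (-e) (-f))))))) / 64 := by
    simp only [signAvg, F]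
    ring
  rw [expand]
  refine div_le_div_of_nonneg_right ?_ (by norm_num)
  linarith [pair (-a) (-b) c (-d) (-e) (-f) (-a) (-b) c d e f (by linarith),
      pair (-a) (-b) (-c) d (-e) (-f) (-a) b (-c) d e f (by linarith),
      pair (-a) (-b) (-c) (-d) e (-f) (-a) b c (-d) e f (by linarith),
      pair (-a) (-b) (-c) (-d) (-e) f (-a) b c d (-e) f (by linarith),
      pair (-a) b (-c) (-d) (-e) (-f) (-a) b c d e (-f) (by linarith),
      pair a (-b) (-c) (-d) (-e) (-f) a (-b) (-c) d e f (by linarith),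
      pair (-a) b c (-d) (-e) (-f) (-a) b c d e f (by linarith),
      pair (-a) (-b) c d (-e) (-f) a (-b) c d e f (by linarith),
      pair (-a) (-b) (-c) d e (-f) a b (-c) d e f (by linarith),
      pair (-a) (-b) (-c) (-d) e f a b c (-d) e f (by linarith),
      pair a (-b) (-c) (-d) (-e) f a b c d (-e) f (by linarith),
      pair a b (-c) (-d) (-e) (-f) a b c d e (-f) (by linarith),
      triple,
      four a b c (-d) (-e) f (a + b + c + f - d - e) (by ring),
      four a b c (-d) e (-f) (a + b + c + e - d - f) (by ring),
      four a b c d (-e) (-f) (a + b + c + d - e - f) (by ring),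
      four a (-b) c (-d) e f (a + c + e + f - b - d) (by ring),
      four a (-b) c d (-e) f (a + c + d + f - b - e) (by ring),
      four a (-b) c d e (-f) (a + c + d + e - b - f) (by ring),
      four a b (-c) (-d) e f (a + b + e + f - c - d) (by ring),
      four a b (-c) d (-e) f (a + b + d + f - c - e) (by ring),
      four a b (-c) d e (-f) (a + b + d + e - c - f) (by ring),
      F_le_one a (-b) c (-d) (-e) (-f),
      F_le_one a (-b) (-c) d (-e) (-f),
      F_le_one a (-b) (-c) (-d) e (-f),
      F_le_one (-a) b (-c) d (-e) (-f),
      F_le_one (-a) b (-c) (-d) e (-f),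
      F_le_one (-a) b (-c) (-d) (-e) f,
      F_le_one (-a) (-b) c (-d) e (-f),
      F_le_one (-a) (-b) c (-d) (-e) f,
      F_le_one (-a) (-b) (-c) d (-e) f,
      F_le_one a b (-c) d (-e) (-f),
      F_le_one a b (-c) (-d) e (-f),
      F_le_one a b (-c) (-d) (-e) f,
      F_le_one a (-b) c d (-e) (-f),
      F_le_one a (-b) c (-d) e (-f),
      F_le_one a (-b) c (-d) (-e) f,
      F_le_one a (-b) (-c) d e (-f),
      F_le_one a (-b) (-c) d (-e) f,
      F_le_one a (-b) (-c) (-d) e f,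
      F_le_one (-a) b c d (-e) (-f),
      F_le_one (-a) b c (-d) e (-f),
      F_le_one (-a) b c (-d) (-e) f,
      F_le_one (-a) b (-c) d e (-f),
      F_le_one (-a) b (-c) d (-e) f,
      F_le_one (-a) b (-c) (-d) e f,
      F_le_one (-a) (-b) c d e (-f),
      F_le_one (-a) (-b) c d (-e) f,
      F_le_one (-a) (-b) c (-d) e f,
      F_le_one (-a) (-b) (-c) d e f]

theorem sum_sq_le_of_nonneg {a b c d e f t : ℝ} (h1 : b ≤ a) (h2 : c ≤ b)
    (h3 : d ≤ c) (h4 : e ≤ d) (h5 : f ≤ e) (h6 : 0 ≤ f)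
    (hab : a + b ≤ t) (h : t ≤ d + e + f)
    (hdf : (a + b + c + e - d - f) ≤ t) (hcf : (a + b + d + e - c - f) ≤ t)
    (hef : (a + b + c + d - e - f) ≤ t) :
    (t - (a + b + c + f - d - e)) ^ 2 +
      (t - (a + b + c + e - d - f)) ^ 2 +
      (t - (a + b + c + d - e - f)) ^ 2 +
      (t - (a + c + e + f - b - d)) ^ 2 +
      (t - (a + c + d + f - b - e)) ^ 2 +
      (t - (a + c + d + e - b - f)) ^ 2 +
      (t - (a + b + e + f - c - d)) ^ 2 +
      (t - (a + b + d + f - c - e)) ^ 2 +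
      (t - (a + b + d + e - c - f)) ^ 2
      ≤ 3 / 2 * (3 / 2 * t ^ 2 - (a ^ 2 + b ^ 2 + c ^ 2 + d ^ 2 + e ^ 2 + f ^ 2)) := by
  have g := sub_nonneg.2 hab
  have g1 := sub_nonneg.2 h1
  have g2 := sub_nonneg.2 h2
  have g3 := sub_nonneg.2 h3
  have g4 := sub_nonneg.2 h4
  have g5 := sub_nonneg.2 h5
  have gh := sub_nonneg.2 h
  have gdf := sub_nonneg.2 hdf
  have gcf := sub_nonneg.2 hcf
  have gef := sub_nonneg.2 hef
  linarith [mul_nonneg g g1,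
      mul_nonneg g g2,
      mul_nonneg g g3,
      mul_nonneg g g4,
      mul_nonneg g gh,
      mul_nonneg g1 g1,
      mul_nonneg g1 g2,
      mul_nonneg g1 g4,
      mul_nonneg g1 g5,
      mul_nonneg g1 h6,
      mul_nonneg g1 gcf,
      mul_nonneg g2 g5,
      mul_nonneg g2 h6,
      mul_nonneg g2 gh,
      mul_nonneg g2 gcf,
      mul_nonneg g3 g5,
      mul_nonneg g3 h6,
      mul_nonneg g3 gdf,
      mul_nonneg g3 gef,
      mul_nonneg g4 h6,
      mul_nonneg g4 gef,
      mul_nonneg g5 h6,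
      mul_nonneg g5 gh,
      mul_nonneg g5 gcf,
      mul_nonneg h6 gcf,
      mul_nonneg gh gef,
      mul_nonneg gdf gcf]

theorem sum_sq_le_of_nonpos {a b c d e f t : ℝ} (h1 : b ≤ a) (h2 : c ≤ b)
    (h3 : d ≤ c) (h4 : e ≤ d) (h5 : f ≤ e) (h6 : 0 ≤ f)
    (hab : a + b ≤ t) (h : t ≤ d + e + f)
    (hdf : (a + b + c + e - d - f) ≤ t) (hcf : (a + b + d + e - c - f) ≤ t)
    (hef : t ≤ (a + b + c + d - e - f)) :
    (t - (a + b + c + f - d - e)) ^ 2 +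
      (t - (a + b + c + e - d - f)) ^ 2 +
      (t - (a + c + e + f - b - d)) ^ 2 +
      (t - (a + c + d + f - b - e)) ^ 2 +
      (t - (a + c + d + e - b - f)) ^ 2 +
      (t - (a + b + e + f - c - d)) ^ 2 +
      (t - (a + b + d + f - c - e)) ^ 2 +
      (t - (a + b + d + e - c - f)) ^ 2
      ≤ 5 / 2 * (3 / 2 * t ^ 2 - (a ^ 2 + b ^ 2 + c ^ 2 + d ^ 2 + e ^ 2 + f ^ 2)) := by
  have g := sub_nonneg.2 hab
  have g1 := sub_nonneg.2 h1
  have g2 := sub_nonneg.2 h2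
  have g3 := sub_nonneg.2 h3
  have g4 := sub_nonneg.2 h4
  have g5 := sub_nonneg.2 h5
  have gh := sub_nonneg.2 h
  have gdf := sub_nonneg.2 hdf
  have gcf := sub_nonneg.2 hcf
  have gef := sub_nonneg.2 hef
  linarith [mul_nonneg g g1,
      mul_nonneg g g2,
      mul_nonneg g h6,
      mul_nonneg g gcf,
      mul_nonneg g gef,
      mul_nonneg g1 g1,
      mul_nonneg g1 g2,
      mul_nonneg g1 g5,
      mul_nonneg g1 h6,
      mul_nonneg g1 gcf,
      mul_nonneg g1 gef,
      mul_nonneg g2 g5,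
      mul_nonneg g2 h6,
      mul_nonneg g2 gh,
      mul_nonneg g2 gef,
      mul_nonneg g3 g5,
      mul_nonneg g3 gdf,
      mul_nonneg g3 gef,
      mul_nonneg g5 g5,
      mul_nonneg g5 h6,
      mul_nonneg g5 gcf,
      mul_nonneg g5 gef,
      mul_nonneg h6 gcf,
      mul_nonneg h6 gef,
      mul_nonneg gh gdf,
      mul_nonneg gh gef]

theorem signAvg.atLeast_nonneg (l : List ℝ) (τ : ℝ) : 0 ≤ signAvg l (atLeast τ) := by
  have h := signAvg.mono l (_root_.atLeast_nonneg τ)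
  rwa [signAvg.const] at h

theorem signAvg.atLeast_of_nonpos (l : List ℝ) {τ : ℝ} (h : τ ≤ 0) :
    signAvg l (atLeast τ) = 1 := by
  rw [_root_.atLeast_of_nonpos h, signAvg.const]

theorem signAvg.atLeast_eq_one_sub (l : List ℝ) (t : ℝ) :
    signAvg l (atLeast t) = 1 - signAvg l (inside t) := by
  have h : atLeast t = fun z => 1 + -1 * inside t z := by
    funext z; rw [atLeast_eq_one_sub_inside]; ring
  rw [h, signAvg.add, signAvg.const, signAvg.const_mul]
  ring

theorem signAvg.quarter_le_of_le_add_add {a b c d e f t : ℝ} (h1 : b ≤ a) (h2 : c ≤ b)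
    (h3 : d ≤ c) (h4 : e ≤ d) (h5 : f ≤ e) (h6 : 0 ≤ f) (hab : a + b < t) (h : t ≤ d + e + f)
    (ht : 0 < t) (r : List ℝ)
    (hr : (r.map (· ^ 2)).sum
      = 3 / 2 * t ^ 2 - (a ^ 2 + b ^ 2 + c ^ 2 + d ^ 2 + e ^ 2 + f ^ 2)) :
    1 / 4 ≤ signAvg (a :: b :: c :: d :: e :: f :: r) (atLeast t) := by
  have hv : 0 < 3 / 2 * t ^ 2 - (a ^ 2 + b ^ 2 + c ^ 2 + d ^ 2 + e ^ 2 + f ^ 2) := by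
    have hb : 0 ≤ b := by linarith
    have q1 : (a + b) ^ 2 < t ^ 2 := pow_lt_pow_left₀ hab (by linarith) two_ne_zero
    have q2 : 0 ≤ (a - b) * (a + 7 * b) := mul_nonneg (by linarith) (by linarith)
    have qc : c ^ 2 ≤ b ^ 2 := by gcongr; linarith
    have qd : d ^ 2 ≤ b ^ 2 := by gcongr <;> linarith
    have qe : e ^ 2 ≤ b ^ 2 := by gcongr <;> linarith
    have qf : f ^ 2 ≤ b ^ 2 := by gcongr; linarith
    linarith
  have pz := fun τ => signAvg.atLeast_ge r τ hv hr
  have sum_ge : 2 ≤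
      signAvg r (atLeast (t - (a + b + c + f - d - e))) +
      signAvg r (atLeast (t - (a + b + c + e - d - f))) +
      signAvg r (atLeast (t - (a + b + c + d - e - f))) +
      signAvg r (atLeast (t - (a + c + e + f - b - d))) +
      signAvg r (atLeast (t - (a + c + d + f - b - e))) +
      signAvg r (atLeast (t - (a + c + d + e - b - f))) +
      signAvg r (atLeast (t - (a + b + e + f - c - d))) +
      signAvg r (atLeast (t - (a + b + d + f - c - e))) +
      signAvg r (atLeast (t - (a + b + d + e - c - f))) := by
    by_cases hef : t ≤ (a + b + c + d - e - f)
    · have e1 := signAvg.atLeast_of_nonpos r (sub_nonpos.2 hef)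
      by_cases hdf : t ≤ (a + b + c + e - d - f)
      · linarith [signAvg.atLeast_of_nonpos r (sub_nonpos.2 hdf),
      signAvg.atLeast_nonneg r (t - (a + b + c + f - d - e)),
      signAvg.atLeast_nonneg r (t - (a + c + e + f - b - d)),
      signAvg.atLeast_nonneg r (t - (a + c + d + f - b - e)),
      signAvg.atLeast_nonneg r (t - (a + c + d + e - b - f)),
      signAvg.atLeast_nonneg r (t - (a + b + e + f - c - d)),
      signAvg.atLeast_nonneg r (t - (a + b + d + f - c - e)),
      signAvg.atLeast_nonneg r (t - (a + b + d + e - c - f))]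
      by_cases hcf : t ≤ (a + b + d + e - c - f)
      · linarith [signAvg.atLeast_of_nonpos r (sub_nonpos.2 hcf),
      signAvg.atLeast_nonneg r (t - (a + b + c + f - d - e)),
      signAvg.atLeast_nonneg r (t - (a + b + c + e - d - f)),
      signAvg.atLeast_nonneg r (t - (a + c + e + f - b - d)),
      signAvg.atLeast_nonneg r (t - (a + c + d + f - b - e)),
      signAvg.atLeast_nonneg r (t - (a + c + d + e - b - f)),
      signAvg.atLeast_nonneg r (t - (a + b + e + f - c - d)),
      signAvg.atLeast_nonneg r (t - (a + b + d + f - c - e))]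
      have q := (div_le_iff₀ hv).2 (sum_sq_le_of_nonpos h1 h2 h3 h4 h5 h6 hab.le h
        (not_le.1 hdf).le (not_le.1 hcf).le hef)
      simp only [add_div] at q
      linarith [pz (t - (a + b + c + f - d - e)),
      pz (t - (a + b + c + e - d - f)),
      pz (t - (a + c + e + f - b - d)),
      pz (t - (a + c + d + f - b - e)),
      pz (t - (a + c + d + e - b - f)),
      pz (t - (a + b + e + f - c - d)),
      pz (t - (a + b + d + f - c - e)),
      pz (t - (a + b + d + e - c - f))]
    · have q := (div_le_iff₀ hv).2 (sum_sq_le_of_nonneg h1 h2 h3 h4 h5 h6 hab.le h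
        (by linarith) (by linarith) (not_le.1 hef).le)
      simp only [add_div] at q
      linarith [pz (t - (a + b + c + f - d - e)),
      pz (t - (a + b + c + e - d - f)),
      pz (t - (a + b + c + d - e - f)),
      pz (t - (a + c + e + f - b - d)),
      pz (t - (a + c + d + f - b - e)),
      pz (t - (a + c + d + e - b - f)),
      pz (t - (a + b + e + f - c - d)),
      pz (t - (a + b + d + f - c - e)),
      pz (t - (a + b + d + e - c - f))]
  have key := signAvg.mono r (signAvg.inside_le_of_chains h1 h2 h3 h4 h5 h ht.le)
  rw [← signAvg.append] at key
  simp only [div_eq_inv_mul, sub_eq_add_neg _ (_ + _), neg_eq_neg_one_mul (_ + _),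
    signAvg.const_mul, signAvg.add, signAvg.const] at key
  have e : signAvg (a :: b :: c :: d :: e :: f :: r) (inside t)
      = signAvg ([a, b, c, d, e, f] ++ r) (inside t) := rfl
  rw [signAvg.atLeast_eq_one_sub, e]
  linarith

theorem cos_le_taylor_four (y : ℝ) (hy : y ^ 2 ≤ 24) :
    Real.cos y ≤ 1 - y ^ 2 / 2 + y ^ 4 / 24 := by
  wlog h : 0 ≤ y generalizing y
  · simpa [show (-y) ^ 4 = y ^ 4 by ring] using this (-y) (by simpa using hy) (by linarith)
  have h1 := Real.sin_ge_sub_cube (x := y / 2) (by linarith)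
  have h2 : 0 ≤ y / 2 - (y / 2) ^ 3 / 6 := by nlinarith
  have h3 := pow_le_pow_left₀ h2 h1 2
  have h4 : Real.cos y = 1 - 2 * Real.sin (y / 2) ^ 2 := by
    rw [← Real.cos_two_mul_eq_one_sub]; congr 1; ring
  nlinarith [sq_nonneg (y ^ 3)]

theorem exp_le_taylor_three {x : ℝ} (h0 : 0 ≤ x) (h1 : x ≤ 1) :
    Real.exp x ≤ 1 + x + x ^ 2 / 2 + 2 / 9 * x ^ 3 := by
  have := Real.exp_bound' h0 h1 (n := 3) (by norm_num)
  norm_num [Finset.sum_range_succ, Nat.factorial] at this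
  linarith

theorem le_exp_neg_of_mul_le {p x : ℝ} (h0 : 0 ≤ x) (h1 : x ≤ 1) (hp : 0 ≤ p)
    (h : p * (1 + x + x ^ 2 / 2 + 2 / 9 * x ^ 3) ≤ 1) : p ≤ Real.exp (-x) := by
  rw [Real.exp_neg, ← one_div, le_div_iff₀ (Real.exp_pos x)]
  exact (mul_le_mul_of_nonneg_left (exp_le_taylor_three h0 h1) hp).trans h

theorem cos_le_exp_neg_half {y : ℝ} (hy : y ^ 2 ≤ 3 / 2) :
    Real.cos y ≤ Real.exp (-(y ^ 2 / 2)) := by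
  refine (cos_le_taylor_four y (by linarith)).trans ?_
  have h0 := sq_nonneg y
  apply le_exp_neg_of_mul_le (by linarith) (by linarith) (by nlinarith)
  have : y ^ 4 = (y ^ 2) ^ 2 := by ring
  rw [this]
  generalize y ^ 2 = w at *
  nlinarith [pow_nonneg h0 2, pow_nonneg h0 3, pow_nonneg h0 4, pow_nonneg h0 5]

theorem cos_le_mul_exp_neg_half {y : ℝ} (hy : y ^ 2 ≤ 3 / 2) (hy' : 9 / 10 ≤ y ^ 2) :
    Real.cos y ≤ 93 / 100 * Real.exp (-(y ^ 2 / 2)) := by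
  rw [← div_le_iff₀' (by norm_num)]
  refine (div_le_div_of_nonneg_right (cos_le_taylor_four y (by linarith)) (by norm_num)).trans ?_
  have h0 := sq_nonneg y
  apply le_exp_neg_of_mul_le (by linarith) (by linarith) (by nlinarith)
  have : y ^ 4 = (y ^ 2) ^ 2 := by ring
  rw [this]
  generalize y ^ 2 = w at *
  nlinarith [mul_nonneg (sub_nonneg.2 hy') (sub_nonneg.2 hy), mul_nonneg (sub_nonneg.2 hy') h0,
    mul_nonneg (sub_nonneg.2 hy') (pow_nonneg h0 2),
    mul_nonneg (sub_nonneg.2 hy') (pow_nonneg h0 3),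
    mul_nonneg (sub_nonneg.2 hy') (pow_nonneg h0 4),
    mul_nonneg (sub_nonneg.2 hy) (pow_nonneg h0 2), mul_nonneg (sub_nonneg.2 hy) (pow_nonneg h0 3)]

theorem cos_le_exp_of_sq_le_aux {y : ℝ} (hy : y ^ 2 ≤ 2.47) :
    Real.cos y ≤ Real.exp (-(0.38 * y ^ 2)) := by
  refine (cos_le_taylor_four y (by linarith)).trans ?_
  have h0 := sq_nonneg y
  apply le_exp_neg_of_mul_le (by positivity) (by linarith) (by nlinarith [sq_nonneg (y ^ 2 - 6)])
  have : y ^ 4 = (y ^ 2) ^ 2 := by ring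
  rw [this]
  generalize y ^ 2 = w at *
  nlinarith [mul_nonneg (sub_nonneg.2 hy) (pow_nonneg h0 1),
    mul_nonneg (sub_nonneg.2 hy) (pow_nonneg h0 2),
    mul_nonneg (sub_nonneg.2 hy) (pow_nonneg h0 3), pow_nonneg h0 2, pow_nonneg h0 3,
    mul_nonneg (sub_nonneg.2 hy) (pow_nonneg h0 4)]

theorem abs_cos_le_max {y : ℝ} (hy : |y| ≤ 3 / 2 * Real.pi) :
    |Real.cos y| ≤ max (Real.cos y) (|y| - Real.pi / 2) := by
  rcases le_total |y| (Real.pi / 2) with h | h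
  · rw [abs_of_nonneg (Real.cos_nonneg_of_mem_Icc (abs_le.1 h))]
    exact le_max_left _ _
  · have h1 : Real.cos y ≤ 0 := by
      rw [← Real.cos_abs]; exact Real.cos_nonpos_of_pi_div_two_le_of_le h (by linarith)
    rw [abs_of_nonpos h1, ← Real.cos_abs, ← Real.sin_sub_pi_div_two]
    exact (Real.sin_le (by linarith)).trans (le_max_right _ _)

theorem cos_le_exp_of_sq_le {y : ℝ} (hy : y ^ 2 ≤ 25 / 6) :
    Real.cos y ≤ Real.exp (-(0.38 * y ^ 2)) := by
  by_cases h : y ^ 2 ≤ 2.47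
  · exact cos_le_exp_of_sq_le_aux h
  · have h1 : Real.pi / 2 ≤ |y| := by
      refine abs_le_of_sq_le_sq' ?_ (abs_nonneg y) |>.2
      rw [sq_abs]
      nlinarith [Real.pi_lt_d4, Real.pi_pos]
    have h2 : |y| ≤ 2.1 := abs_le_of_sq_le_sq (by linarith) (by norm_num)
    rw [← Real.cos_abs]
    exact (Real.cos_nonpos_of_pi_div_two_le_of_le h1 (by linarith [Real.pi_gt_d4])).trans
      (Real.exp_pos _).le

theorem abs_cos_le_exp_of_sq_le {y : ℝ} (hy : y ^ 2 ≤ 27 / 8) :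
    |Real.cos y| ≤ Real.exp (-(0.38 * y ^ 2)) := by
  have h2 : |y| ≤ 1.8372 := abs_le_of_sq_le_sq (by linarith) (by norm_num)
  refine (abs_cos_le_max (by linarith [Real.pi_gt_d4])).trans
    (max_le (cos_le_exp_of_sq_le (by linarith)) ?_)
  have h3 : (0.2665 : ℝ) * Real.exp 1 ≤ Real.exp (-0.2825) := by
    refine le_trans ?_ (le_exp_neg_of_mul_le (p := 0.73) (by norm_num) (by norm_num) (by norm_num)
      (by norm_num))
    linarith [Real.exp_one_lt_d9]
  calc |y| - Real.pi / 2 ≤ 0.2665 := by linarith [Real.pi_gt_d4]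
    _ ≤ Real.exp (-0.2825) * Real.exp (-1) := by
      rw [Real.exp_neg 1, ← div_eq_mul_inv, le_div_iff₀ (Real.exp_pos 1)]; exact h3
    _ ≤ _ := by rw [← Real.exp_add]; exact Real.exp_le_exp.2 (by linarith)

theorem abs_cos_le_exp_of_sq_le' {y : ℝ} (hy : y ^ 2 ≤ 25 / 6) :
    |Real.cos y| ≤ Real.exp (-(0.18 * y ^ 2)) := by
  have h2 : |y| ≤ 2.0413 := abs_le_of_sq_le_sq (by linarith) (by norm_num)
  refine (abs_cos_le_max (by linarith [Real.pi_gt_d4])).trans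
    (max_le ((cos_le_exp_of_sq_le hy).trans (Real.exp_le_exp.2 (by linarith [sq_nonneg y]))) ?_)
  have h3 : (0.686 : ℝ) ≤ Real.exp (-0.375) :=
    le_exp_neg_of_mul_le (by norm_num) (by norm_num) (by norm_num) (by norm_num)
  calc |y| - Real.pi / 2 ≤ 0.686 * 0.686 := by linarith [Real.pi_gt_d4]
    _ ≤ Real.exp (-0.375) * Real.exp (-0.375) := by gcongr
    _ ≤ _ := by rw [← Real.exp_add]; exact Real.exp_le_exp.2 (by linarith)

/-- A bound on each factor of a product of cosines bounds the product. -/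
theorem abs_prod_map_le_exp (l : List ℝ) (f : ℝ → ℝ) (μ : ℝ)
    (h : ∀ a ∈ l, |f a| ≤ Real.exp (-(μ * a ^ 2))) :
    |(l.map f).prod| ≤ Real.exp (-(μ * (l.map (· ^ 2)).sum)) := by
  induction l with
  | nil => simp
  | cons a l ih =>
    rw [List.forall_mem_cons] at h
    rw [List.map_cons, List.prod_cons, abs_mul, List.map_cons, List.sum_cons, mul_add, neg_add,
      Real.exp_add]
    exact mul_le_mul h.1 (ih h.2) (abs_nonneg _) (Real.exp_pos _).le

theorem one_le_quintic {Y : ℝ} (h : 0.3387 ≤ Y) :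
    1 ≤ 0.546 + 1.604 * Y - 2.432 * Y ^ 3 + 1.328 * Y ^ 5 := by
  have hK : 0 ≤ 1.328 * Y ^ 3 + 2.3680896 * Y ^ 2 + 0.73508303104 * Y - 0.571714092699648 := by
    nlinarith
  nlinarith [mul_nonneg (sq_nonneg (Y - 0.8916)) hK]

theorem quintic_nonneg {Y : ℝ} (h0 : -1 ≤ Y) (h1 : Y ≤ 1) :
    0 ≤ 0.546 + 1.604 * Y - 2.432 * Y ^ 3 + 1.328 * Y ^ 5 := by
  have hK : 0 ≤ 1.328 * Y ^ 3 - 1.463456 * Y ^ 2 - 1.222453616 * Y + 1.791450589888 := by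
    nlinarith [mul_nonneg (sub_nonneg.2 h1) (sub_nonneg.2 h1),
      mul_nonneg (neg_le_iff_add_nonneg.1 h0) (sq_nonneg (Y - 1))]
  nlinarith [mul_nonneg (sq_nonneg (Y + 0.551)) hK]

theorem le_cos_of_sq_le {y : ℝ} (hy : y ^ 2 ≤ 3 / 2) : 0.3387 ≤ Real.cos y := by
  wlog h : 0 ≤ y generalizing y
  · simpa using this (y := -y) (by simpa using hy) (by linarith)
  have h1 : y / 2 ≤ 0.61238 := abs_le_of_sq_le_sq' (by linarith) (by norm_num) |>.2
  have h2 := Real.sin_le_sin_of_le_of_le_pi_div_two (x := y / 2) (y := 0.61238)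
    (by linarith [Real.pi_gt_d4]) (by linarith [Real.pi_gt_d4]) h1
  have h3 := (abs_le.1 (Real.sin_bound (x := 0.61238) (by norm_num [abs_le]))).2
  have h4 : 0 ≤ Real.sin (y / 2) := Real.sin_nonneg_of_nonneg_of_le_pi (by linarith)
    (by linarith [Real.pi_gt_d4])
  have h5 : Real.sin (y / 2) ≤ 0.575 := by
    rw [abs_of_pos (by norm_num)] at h3
    norm_num at h3 h2 ⊢
    linarith
  have h6 : Real.cos y = 1 - 2 * Real.sin (y / 2) ^ 2 := by
    rw [← Real.cos_two_mul_eq_one_sub]; congr 1; ring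
  nlinarith

theorem cos_five_mul (x : ℝ) :
    Real.cos (5 * x) = 16 * Real.cos x ^ 5 - 20 * Real.cos x ^ 3 + 5 * Real.cos x := by
  have h1 := Real.cos_add (3 * x) (2 * x)
  have h2 := Real.cos_sub (3 * x) (2 * x)
  rw [show 3 * x + 2 * x = 5 * x by ring] at h1
  rw [show 3 * x - 2 * x = x by ring] at h2
  have h3 : Real.cos (5 * x) = 2 * Real.cos (3 * x) * Real.cos (2 * x) - Real.cos x := by linarith
  rw [h3, Real.cos_three_mul, Real.cos_two_mul]
  ring

/-- A trigonometric polynomial majorant of the indicator of `(-t, t)`. -/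
theorem inside_le_trig {t : ℝ} (ht : t ^ 2 = 2 / 3) (z : ℝ) :
    inside t z ≤ 0.546 + 0.61 * Real.cos (3 / 2 * z) + -0.193 * Real.cos (9 / 2 * z)
      + 0.083 * Real.cos (15 / 2 * z) := by
  have e3 : Real.cos (9 / 2 * z) = Real.cos (3 * (3 / 2 * z)) := by congr 1; ring
  have e5 : Real.cos (15 / 2 * z) = Real.cos (5 * (3 / 2 * z)) := by congr 1; ring
  rw [e3, e5, Real.cos_three_mul, cos_five_mul]
  unfold inside
  split_ifs with h
  · have hz : (3 / 2 * z) ^ 2 ≤ 3 / 2 := by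
      have := sq_lt_sq.2 (h.trans_le (le_abs_self t))
      linarith
    linarith [one_le_quintic (le_cos_of_sq_le hz)]
  · linarith [quintic_nonneg (Real.neg_one_le_cos (3 / 2 * z)) (Real.cos_le_one _)]

theorem exp_neg_natCast_add_le (k : ℕ) {x c : ℝ} (hx : 0 ≤ x) (hc : 0 ≤ c)
    (h : 1 ≤ c * (2.718281 ^ k * (1 + x + x ^ 2 / 2))) : Real.exp (-(k + x)) ≤ c := by
  rw [Real.exp_neg, inv_le_iff_one_le_mul₀ (Real.exp_pos _), Real.exp_add, ← Real.exp_one_pow]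
  refine h.trans (mul_le_mul_of_nonneg_left ?_ hc)
  have := Real.exp_one_gt_d9
  gcongr
  · linarith
  · exact Real.quadratic_le_exp_of_nonneg hx

theorem signAvg.inside_le_trig (l : List ℝ) {t : ℝ} (ht : t ^ 2 = 2 / 3) :
    signAvg l (inside t) ≤ 0.546 + 0.61 * (l.map fun a => Real.cos (3 / 2 * a)).prod
      + -0.193 * (l.map fun a => Real.cos (9 / 2 * a)).prod
      + 0.083 * (l.map fun a => Real.cos (15 / 2 * a)).prod := by
  have h := signAvg.mono l (_root_.inside_le_trig ht)
  simpa only [signAvg.add, signAvg.const, signAvg.const_mul, signAvg.cos_mul] using h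

theorem signAvg.quarter_le_of_add_add_le {a b c d e f t : ℝ} (h1 : b ≤ a) (h2 : c ≤ b)
    (h3 : d ≤ c) (h4 : e ≤ d) (h5 : f ≤ e) (h6 : 0 ≤ f) (hab : a + b ≤ t) (h : d + e + f ≤ t)
    (ht : t ^ 2 = 2 / 3) (r : List ℝ) (hf : ∀ x ∈ r, x ^ 2 ≤ f ^ 2)
    (hr : a ^ 2 + (b ^ 2 + (c ^ 2 + (d ^ 2 + (e ^ 2 + (f ^ 2 + (r.map (· ^ 2)).sum))))) = 1) :
    1 / 4 ≤ signAvg (a :: b :: c :: d :: e :: f :: r) (atLeast t) := by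
  have hfe : f ^ 2 ≤ e ^ 2 := by gcongr
  have hed : e ^ 2 ≤ d ^ 2 := by gcongr; linarith
  have hdc : d ^ 2 ≤ c ^ 2 := by gcongr; linarith
  have hcb : c ^ 2 ≤ b ^ 2 := by gcongr; linarith
  have hb : b ^ 2 ≤ 1 / 6 := by
    have : b ^ 2 ≤ (t / 2) ^ 2 := by gcongr <;> linarith
    linarith
  have ha : a ^ 2 ≤ 2 / 3 := by
    have : a ^ 2 ≤ t ^ 2 := by gcongr <;> linarith
    linarith
  have hall : ∀ x ∈ b :: c :: d :: e :: f :: r, x ^ 2 ≤ 1 / 6 := by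
    simp only [List.forall_mem_cons]
    exact ⟨hb, by linarith, by linarith, by linarith, by linarith,
      fun x hx => by linarith [hf x hx]⟩
  have hsum : ((b :: c :: d :: e :: f :: r).map (· ^ 2)).sum = 1 - a ^ 2 := by
    simp only [List.map_cons, List.sum_cons]; linarith
  have hone {x : ℝ} (hx : x ^ 2 ≤ 2 / 3) :
      |Real.cos (3 / 2 * x)| ≤ Real.exp (-(9 / 8 * x ^ 2)) := by
    have hx' : (3 / 2 * x) ^ 2 ≤ 3 / 2 := by linarith
    rw [abs_of_nonneg (by linarith [le_cos_of_sq_le hx'])]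
    exact (cos_le_exp_neg_half hx').trans_eq (by congr 1; ring)
  have φ1 : |((b :: c :: d :: e :: f :: r).map fun x => Real.cos (3 / 2 * x)).prod|
      ≤ Real.exp (-(9 / 8 * (1 - a ^ 2))) := by
    rw [← hsum]
    exact abs_prod_map_le_exp _ _ _ fun x hx => hone ((hall x hx).trans (by norm_num))
  have φ3 : |((b :: c :: d :: e :: f :: r).map fun x => Real.cos (9 / 2 * x)).prod|
      ≤ Real.exp (-(7.695 * (1 - a ^ 2))) := by
    rw [← hsum]
    exact abs_prod_map_le_exp _ _ _ fun x hx =>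
      (abs_cos_le_exp_of_sq_le (by linarith [hall x hx])).trans_eq (by congr 1; ring)
  have φ5 : |((f :: r).map fun x => Real.cos (15 / 2 * x)).prod| ≤ 0.0345 := by
    have e1 : Real.exp (-(((3 : ℕ) : ℝ) + 0.375)) ≤ 0.0345 :=
      exp_neg_natCast_add_le 3 (by norm_num) (by norm_num) (by norm_num)
    refine le_trans ?_ e1
    have hT : ((f :: r).map (· ^ 2)).sum = 1 - (a ^ 2 + b ^ 2 + c ^ 2 + d ^ 2 + e ^ 2) := by
      simp only [List.map_cons, List.sum_cons]; linarith
    have hfr : ∀ x ∈ f :: r, x ^ 2 ≤ f ^ 2 := List.forall_mem_cons.2 ⟨le_rfl, hf⟩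
    by_cases hf3 : f ≤ 0.3 * t
    · have hf2 : f ^ 2 ≤ 0.06 := by
        have : f ^ 2 ≤ (0.3 * t) ^ 2 := by gcongr
        linarith
      refine (abs_prod_map_le_exp _ _ 21.375 fun x hx =>
        (abs_cos_le_exp_of_sq_le (by linarith [hfr x hx])).trans_eq (by congr 1; ring)).trans ?_
      rw [hT, Real.exp_le_exp]
      have q1 : (a + b) ^ 2 ≤ t ^ 2 := by gcongr; linarith
      have q2 : 0 ≤ (a - b) * (a + 11 * b) := mul_nonneg (by linarith) (by linarith)
      norm_num
      linarith
    · rw [not_le] at hf3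
      have hf2 : f ^ 2 ≤ 2 / 27 := by
        have : f ^ 2 ≤ (t / 3) ^ 2 := by gcongr; linarith
        linarith
      refine (abs_prod_map_le_exp _ _ 10.125 fun x hx =>
        (abs_cos_le_exp_of_sq_le' (by linarith [hfr x hx])).trans_eq (by congr 1; ring)).trans ?_
      rw [hT, Real.exp_le_exp]
      have q1 : a ^ 2 ≤ (t - b) ^ 2 := by gcongr <;> linarith
      have q2 : 0 ≤ (b - 0.3 * t) * (t / 2 - b) := mul_nonneg (by linarith) (by linarith)
      have q3 : 0 ≤ t * (t / 2 - b) := mul_nonneg (by linarith) (by linarith)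
      have q4 : d ^ 2 + e ^ 2 ≤ t ^ 2 / 4 := by
        have q5 : d ^ 2 ≤ (0.7 * t - e) ^ 2 := by gcongr <;> linarith
        have q6 : 0 ≤ (e - 0.3 * t) * (0.4 * t - e) := mul_nonneg (by linarith) (by linarith)
        nlinarith
      norm_num
      linarith
  have e98 : Real.exp (-(9 / 8)) ≤ 0.3248 := by
    have := exp_neg_natCast_add_le 1 (x := 1 / 8) (c := 0.3248) (by norm_num) (by norm_num)
      (by norm_num)
    norm_num at this ⊢
    exact this
  have drop {x : ℝ} {y : ℝ} : |Real.cos x * y| ≤ |y| := by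
    rw [abs_mul]; exact mul_le_of_le_one_left (abs_nonneg _) (Real.abs_cos_le_one x)
  have key := signAvg.inside_le_trig (a :: b :: c :: d :: e :: f :: r) ht
  have p5 : ((a :: b :: c :: d :: e :: f :: r).map fun x => Real.cos (15 / 2 * x)).prod
      ≤ 0.0345 := by
    refine (le_abs_self _).trans (le_trans ?_ φ5)
    simp only [List.map_cons, List.prod_cons]
    exact drop.trans (drop.trans (drop.trans (drop.trans drop)))
  have p3 : -Real.exp (-(7.695 * (1 - a ^ 2)))
      ≤ ((a :: b :: c :: d :: e :: f :: r).map fun x => Real.cos (9 / 2 * x)).prod := by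
    refine (abs_le.1 (le_trans ?_ φ3)).1
    rw [List.map_cons, List.prod_cons]
    exact drop
  rw [signAvg.atLeast_eq_one_sub]
  rcases le_total (a ^ 2) 0.4 with hu | hu
  · have p1 : ((a :: b :: c :: d :: e :: f :: r).map fun x => Real.cos (3 / 2 * x)).prod
        ≤ 0.3248 := by
      refine (le_abs_self _).trans (le_trans ?_ e98)
      rw [List.map_cons, List.prod_cons, abs_mul]
      refine (mul_le_mul (hone ha) φ1 (abs_nonneg _) (Real.exp_pos _).le).trans_eq ?_
      rw [← Real.exp_add]; congr 1; ring
    have e3 : Real.exp (-(7.695 * (1 - a ^ 2))) ≤ 0.0105 := by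
      refine le_trans (Real.exp_le_exp.2 ?_)
        (exp_neg_natCast_add_le 4 (x := 0.617) (by norm_num) (by norm_num) (by norm_num))
      norm_num
      linarith
    linarith
  · have p1 : ((a :: b :: c :: d :: e :: f :: r).map fun x => Real.cos (3 / 2 * x)).prod
        ≤ 0.93 * 0.3248 := by
      refine (le_abs_self _).trans (le_trans ?_ (mul_le_mul_of_nonneg_left e98 (by norm_num)))
      have hx : (3 / 2 * a) ^ 2 ≤ 3 / 2 := by linarith
      rw [List.map_cons, List.prod_cons, abs_mul,
        abs_of_nonneg (by linarith [le_cos_of_sq_le hx])]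
      refine (mul_le_mul (cos_le_mul_exp_neg_half hx (by linarith)) φ1 (abs_nonneg _)
        (by positivity)).trans_eq ?_
      rw [mul_assoc, ← Real.exp_add]; norm_num; ring
    have e3 : Real.exp (-(7.695 * (1 - a ^ 2))) ≤ 0.08 := by
      refine le_trans (Real.exp_le_exp.2 ?_)
        (exp_neg_natCast_add_le 2 (x := 0.565) (by norm_num) (by norm_num) (by norm_num))
      norm_num
      linarith
    linarith

theorem exists_six_cons_of_le_length {α : Type*} (l : List α) (h : 6 ≤ l.length) :
    ∃ a b c d e f r, l = a :: b :: c :: d :: e :: f :: r := by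
  match l, h with
  | a :: b :: c :: d :: e :: f :: r, _ => exact ⟨a, b, c, d, e, f, r, rfl⟩

theorem signAvg.quarter_le {t : ℝ} (ht : 0 < t) (ht2 : t ^ 2 = 2 / 3) (l : List ℝ)
    (hl : (l.map (· ^ 2)).sum = 1) : 1 / 4 ≤ signAvg l (atLeast t) := by
  have hperm := List.perm_insertionSort (· ≥ ·) (l.map abs ++ List.replicate 6 0)
  have hsort := List.pairwise_insertionSort (· ≥ ·) (l.map abs ++ List.replicate 6 0)
  have hnn : ∀ x ∈ (l.map abs ++ List.replicate 6 0).insertionSort (· ≥ ·), 0 ≤ x := by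
    intro x hx
    rcases List.mem_append.1 (hperm.mem_iff.1 hx) with hx | hx
    · obtain ⟨y, -, rfl⟩ := List.mem_map.1 hx
      exact abs_nonneg y
    · exact (List.eq_of_mem_replicate hx).ge
  have havg : signAvg ((l.map abs ++ List.replicate 6 0).insertionSort (· ≥ ·)) (atLeast t)
      = signAvg l (atLeast t) := by
    rw [signAvg.perm hperm, signAvg.append, signAvg.replicate_zero, signAvg.map_abs]
    simp only [add_zero]
  have hsum : (((l.map abs ++ List.replicate 6 0).insertionSort (· ≥ ·)).map (· ^ 2)).sum = 1 := by
    rw [(hperm.map _).sum_eq, ← hl]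
    simp [Function.comp_def]
  have hlen : 6 ≤ ((l.map abs ++ List.replicate 6 0).insertionSort (· ≥ ·)).length := by
    simp
  obtain ⟨a, b, c, d, e, f, r, hm⟩ := exists_six_cons_of_le_length _ hlen
  rw [← havg]
  rw [hm] at hsort hnn hsum ⊢
  simp only [List.pairwise_cons, List.forall_mem_cons] at hsort hnn
  obtain ⟨⟨h1, -⟩, ⟨h2, -⟩, ⟨h3, -⟩, ⟨h4, -⟩, ⟨h5, -⟩, hr, -⟩ := hsort
  obtain ⟨-, -, -, -, -, h6, hr0⟩ := hnn
  simp only [List.map_cons, List.sum_cons] at hsum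
  rcases le_or_gt t (a + b) with hab | hab
  · exact signAvg.quarter_le_of_le_add a b t _ hab
  rcases le_total t (d + e + f) with h | h
  · exact signAvg.quarter_le_of_le_add_add h1 h2 h3 h4 h5 h6 hab h ht r (by linarith)
  · exact signAvg.quarter_le_of_add_add_le h1 h2 h3 h4 h5 h6 hab.le h ht2 r
      (fun x hx => pow_le_pow_left₀ (hr0 x hx) (hr x hx) 2) hsum

theorem abs_rademacher_ge_two_div_sqrt6 (n : ℕ) (hn : 0 < n) (a : Fin n → ℝ)
    (hnorm : ∑ i, (a i) ^ 2 = 1) :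
    radProb a (fun x => |x| ≥ 2 / Real.sqrt 6) ≥ 1 / 4 := by
  rw [radProb_eq_signAvg]
  convert signAvg.quarter_le (t := 2 / Real.sqrt 6) (by positivity)
    (by rw [div_pow, Real.sq_sqrt (by norm_num)]; norm_num) (List.ofFn a)
    (by rw [List.map_ofFn, List.sum_ofFn]; exact hnorm) using 2
  funext y
  simp only [atLeast, ge_iff_le]
end

section
/- For every finite Rademacher sum X = Σ_{i=1}^n a_i ε_i with Var(X) > 0, one has P(X ≥ 0.35 √(Var(X))) ≥ 1/4. -/
/-- The expectation of `f (x + ∑ aᵢ εᵢ)` for independent uniform signs `εᵢ`, where the `aᵢ` are the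
entries of the list. -/
noncomputable def signExp : List ℝ → (ℝ → ℝ) → ℝ → ℝ
  | [], f, x => f x
  | a :: l, f, x => (signExp l f (x + a) + signExp l f (x - a)) / 2

theorem signExp_perm {l l' : List ℝ} (h : l.Perm l') (f : ℝ → ℝ) (x : ℝ) :
    signExp l f x = signExp l' f x := by
  induction h generalizing x with
  | nil => rfl
  | cons a _ ih => simp only [signExp, ih]
  | swap a b l =>
    simp only [signExp]
    rw [show x + b - a = x - a + b by ring, show x + b + a = x + a + b by ring,
      show x - b + a = x + a - b by ring, show x - b - a = x - a - b by ring]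
    ring
  | trans _ _ ih₁ ih₂ => rw [ih₁, ih₂]

theorem signExp_merge (r a : ℝ) (l : List ℝ) (f : ℝ → ℝ) :
    signExp (r :: a :: l) f 0 =
      (signExp ((r + a) :: l) f 0 + signExp ((r - a) :: l) f 0) / 2 := by
  simp only [signExp]
  rw [show (0 : ℝ) + r + a = 0 + (r + a) by ring, show (0 : ℝ) + r - a = 0 + (r - a) by ring,
    show (0 : ℝ) - r + a = 0 - (r - a) by ring, show (0 : ℝ) - r - a = 0 - (r + a) by ring]
  ring

theorem signExp_neg_cons (a : ℝ) (l : List ℝ) (f : ℝ → ℝ) (x : ℝ) :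
    signExp (-a :: l) f x = signExp (a :: l) f x := by
  simp only [signExp]
  rw [← sub_eq_add_neg, sub_neg_eq_add, add_comm]

theorem signExp_abs_cons (a : ℝ) (l : List ℝ) (f : ℝ → ℝ) (x : ℝ) :
    signExp (|a| :: l) f x = signExp (a :: l) f x := by
  rcases abs_choice a with h | h <;> rw [h]
  exact signExp_neg_cons a l f x

theorem signExp_map_abs (l : List ℝ) (f : ℝ → ℝ) (x : ℝ) :
    signExp (l.map fun a => |a|) f x = signExp l f x := by
  induction l generalizing x with
  | nil => rfl
  | cons a l ih => rw [List.map_cons, signExp_abs_cons]; simp only [signExp, ih]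

theorem signExp_map_mul (c : ℝ) (l : List ℝ) (f : ℝ → ℝ) (x : ℝ) :
    signExp (l.map fun a => c * a) f (c * x) = signExp l (fun y => f (c * y)) x := by
  induction l generalizing x with
  | nil => rfl
  | cons a l ih => simp only [List.map_cons, signExp, ← mul_add, ← mul_sub, ih]

theorem signExp_add (l : List ℝ) (f g : ℝ → ℝ) (x : ℝ) :
    signExp l (fun y => f y + g y) x = signExp l f x + signExp l g x := by
  induction l generalizing x with
  | nil => rfl
  | cons a l ih => simp only [signExp, ih]; ring

theorem signExp_const (l : List ℝ) (c x : ℝ) : signExp l (fun _ => c) x = c := by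
  induction l generalizing x with
  | nil => rfl
  | cons a l ih => simp only [signExp, ih]; ring

theorem signExp_comp_neg (l : List ℝ) (f : ℝ → ℝ) (x : ℝ) :
    signExp l (fun y => f (-y)) x = signExp l f (-x) := by
  induction l generalizing x with
  | nil => rfl
  | cons a l ih =>
    simp only [signExp, ih]
    rw [show -(x + a) = -x - a by ring, show -(x - a) = -x + a by ring, add_comm]

/-- A pointwise bound on `signExp l f` survives adding further summands. -/
theorem signExp_append_le {l : List ℝ} {f : ℝ → ℝ} {c : ℝ} (h : ∀ x, signExp l f x ≤ c)
    (m : List ℝ) (x : ℝ) : signExp (l ++ m) f x ≤ c := by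
  rw [signExp_perm List.perm_append_comm]
  induction m generalizing x with
  | nil => exact h x
  | cons a m ih =>
    simp only [List.cons_append, signExp]
    linarith [ih (x + a), ih (x - a)]

/-- The indicator function of the open interval `(-t, t)`. -/
noncomputable def ballInd (t x : ℝ) : ℝ := if |x| < t then 1 else 0

theorem ballInd_nonneg (t x : ℝ) : 0 ≤ ballInd t x := by
  unfold ballInd; split_ifs <;> norm_num

theorem ballInd_le_one (t x : ℝ) : ballInd t x ≤ 1 := by
  unfold ballInd; split_ifs <;> norm_num

theorem ballInd_eq_zero_of_two_mul_le {t x y : ℝ} (h : x + 2 * t ≤ y) :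
    ballInd t x = 0 ∨ ballInd t y = 0 := by
  unfold ballInd
  by_cases hx : |x| < t
  · right
    refine if_neg fun hy => ?_
    linarith [(abs_lt.1 hx).1, (abs_lt.1 hy).2]
  · exact Or.inl (if_neg hx)

theorem ballInd_add_le_one {t x y : ℝ} (h : x + 2 * t ≤ y) : ballInd t x + ballInd t y ≤ 1 := by
  rcases ballInd_eq_zero_of_two_mul_le h with h | h <;>
    linarith [ballInd_le_one t x, ballInd_le_one t y]

theorem ballInd_add_add_add_le_one {t x y z w : ℝ} (ht : 0 ≤ t) (h₁ : x + 2 * t ≤ y)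
    (h₂ : y + 2 * t ≤ z) (h₃ : z + 2 * t ≤ w) :
    ballInd t x + ballInd t y + ballInd t z + ballInd t w ≤ 1 := by
  have e₁ := ballInd_eq_zero_of_two_mul_le h₁
  have e₂ := ballInd_eq_zero_of_two_mul_le h₂
  have e₃ := ballInd_eq_zero_of_two_mul_le h₃
  have e₄ := ballInd_eq_zero_of_two_mul_le (show x + 2 * t ≤ z by linarith)
  have e₅ := ballInd_eq_zero_of_two_mul_le (show x + 2 * t ≤ w by linarith)
  have e₆ := ballInd_eq_zero_of_two_mul_le (show y + 2 * t ≤ w by linarith)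
  have b₁ := ballInd_le_one t x
  have b₂ := ballInd_le_one t y
  have b₃ := ballInd_le_one t z
  have b₄ := ballInd_le_one t w
  grind

/-- The Littlewood–Offord bound for `k` summands of size at least the radius, capped at `k = 3`. -/
noncomputable def offordBound : ℕ → ℝ
  | 0 => 1
  | 1 => 1 / 2
  | 2 => 1 / 2
  | _ => 3 / 8

theorem signExp_ballInd_le_one (t : ℝ) (l : List ℝ) (x : ℝ) : signExp l (ballInd t) x ≤ 1 :=
  signExp_append_le (l := []) (fun x => ballInd_le_one t x) l x

theorem signExp_ballInd_cons_le {t b : ℝ} (hb : t ≤ b) (l : List ℝ) (x : ℝ) :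
    signExp (b :: l) (ballInd t) x ≤ 1 / 2 := by
  refine signExp_append_le (l := [b]) (fun x => ?_) l x
  simp only [signExp]
  linarith [ballInd_add_le_one (show x - b + 2 * t ≤ x + b by linarith)]

theorem signExp_ballInd_cons_cons_cons_le {t b₁ b₂ b₃ : ℝ} (ht : 0 ≤ t) (h₁ : t ≤ b₁)
    (h₂ : t ≤ b₂) (h₃ : t ≤ b₃) (l : List ℝ) (x : ℝ) :
    signExp (b₁ :: b₂ :: b₃ :: l) (ballInd t) x ≤ 3 / 8 := by
  refine signExp_append_le (l := [b₁, b₂, b₃]) (fun x => ?_) l x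
  simp only [signExp]
  have c₁ := ballInd_add_add_add_le_one (x := x - b₁ - b₂ - b₃) (y := x + b₁ - b₂ - b₃)
    (z := x + b₁ + b₂ - b₃) (w := x + b₁ + b₂ + b₃) ht (by linarith) (by linarith) (by linarith)
  have c₂ := ballInd_add_le_one (show x - b₁ + b₂ - b₃ + 2 * t ≤ x - b₁ + b₂ + b₃ by linarith)
  have c₃ := ballInd_add_le_one (show x - b₁ - b₂ + b₃ + 2 * t ≤ x + b₁ - b₂ + b₃ by linarith)
  linarith

theorem signExp_ballInd_append_le {t : ℝ} (ht : 0 ≤ t) (B N : List ℝ) (hB : ∀ b ∈ B, t ≤ b)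
    (x : ℝ) : signExp (B ++ N) (ballInd t) x ≤ offordBound B.length := by
  match B, hB with
  | [], _ => exact signExp_ballInd_le_one t _ x
  | [b], hB => exact signExp_ballInd_cons_le (hB b (by simp)) _ x
  | [b, c], hB => exact signExp_ballInd_cons_le (hB b (by simp)) _ x
  | b :: c :: d :: B, hB =>
    exact signExp_ballInd_cons_cons_cons_le ht (hB b (by simp)) (hB c (by simp)) (hB d (by simp)) _ x

/-- `IsSmallBallBound t M w`: in the presence of `k` summands of size at least `t`, and arbitrary
other ones, the sum over `M` lies in `(-t, t)` with probability at most `w k`. -/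
def IsSmallBallBound (t : ℝ) (M : List ℝ) (w : ℕ → ℝ) : Prop :=
  ∀ B N : List ℝ, (∀ b ∈ B, t ≤ b) → signExp (M ++ (B ++ N)) (ballInd t) 0 ≤ w B.length

theorem isSmallBallBound_offordBound {t : ℝ} (ht : 0 ≤ t) (M : List ℝ) :
    IsSmallBallBound t M offordBound := by
  intro B N hB
  have hp : (M ++ (B ++ N)).Perm (B ++ (M ++ N)) := by
    rw [← List.append_assoc, ← List.append_assoc]
    exact List.perm_append_comm.append_right N
  rw [signExp_perm hp]
  exact signExp_ballInd_append_le ht B _ hB 0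

theorem IsSmallBallBound.pair {t a b : ℝ} {M : List ℝ} {w : ℕ → ℝ}
    (h : IsSmallBallBound t M w) (hab : t ≤ a + b) :
    IsSmallBallBound t (a :: b :: M) (fun k => (w (k + 1) + w k) / 2) := by
  intro B N hB
  have h₁ := h ((a + b) :: B) N (by simpa using ⟨hab, hB⟩)
  have h₂ := h B ((a - b) :: N) hB
  rw [signExp_perm (show (M ++ ((a + b) :: B ++ N)).Perm ((a + b) :: (M ++ (B ++ N))) from
    List.perm_middle)] at h₁
  have hp : (M ++ (B ++ (a - b) :: N)).Perm ((a - b) :: (M ++ (B ++ N))) :=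
    (List.Perm.append_left M List.perm_middle).trans List.perm_middle
  rw [signExp_perm hp] at h₂
  simp only [List.length_cons] at h₁
  rw [List.cons_append, List.cons_append, signExp_merge]
  linarith

/-- The walk starting at `r` with step sizes `l` restarts at `0` whenever it leaves `(-t, t)`;
`exitDeficit t l k r` is the probability that this happens fewer than `k` times. -/
noncomputable def exitDeficit (t : ℝ) : List ℝ → ℕ → ℝ → ℝ
  | _, 0, _ => 0
  | [], _ + 1, _ => 1
  | a :: l, k + 1, r =>
    ((if |r + a| < t then exitDeficit t l (k + 1) (r + a) else exitDeficit t l k 0) +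
      (if |r - a| < t then exitDeficit t l (k + 1) (r - a) else exitDeficit t l k 0)) / 2

theorem exitDeficit_zero (t : ℝ) (l : List ℝ) (r : ℝ) : exitDeficit t l 0 r = 0 := by
  cases l <;> rfl

theorem exitDeficit_cons (t a : ℝ) (l : List ℝ) (k : ℕ) (r : ℝ) :
    exitDeficit t (a :: l) k r =
    ((if |r + a| < t then exitDeficit t l k (r + a) else exitDeficit t l (k - 1) 0) +
      (if |r - a| < t then exitDeficit t l k (r - a) else exitDeficit t l (k - 1) 0)) / 2 := by
  cases k with
  | zero => simp [exitDeficit_zero]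
  | succ k => rfl

theorem exitDeficit_nonneg (t : ℝ) (l : List ℝ) (k : ℕ) (r : ℝ) : 0 ≤ exitDeficit t l k r := by
  induction l generalizing k r with
  | nil => cases k <;> simp [exitDeficit]
  | cons a l ih =>
    rw [exitDeficit_cons]
    have h₁ := ih k (r + a)
    have h₂ := ih k (r - a)
    have h₃ := ih (k - 1) 0
    split_ifs <;> linarith

theorem exitDeficit_le_one (t : ℝ) (l : List ℝ) (k : ℕ) (r : ℝ) : exitDeficit t l k r ≤ 1 := by
  induction l generalizing k r with
  | nil => cases k <;> simp [exitDeficit]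
  | cons a l ih =>
    rw [exitDeficit_cons]
    have h₁ := ih k (r + a)
    have h₂ := ih k (r - a)
    have h₃ := ih (k - 1) 0
    split_ifs <;> linarith

theorem isSmallBallBound_exitDeficit {t : ℝ} (ht : 0 ≤ t) (l : List ℝ) (r : ℝ) :
    IsSmallBallBound t (r :: l) (fun k =>
      3 / 8 + exitDeficit t l (3 - k) r / 8 + exitDeficit t l (1 - k) r / 2) := by
  induction l generalizing r with
  | nil =>
    intro B N hB
    refine (isSmallBallBound_offordBound ht [r] B N hB).trans (le_of_eq ?_)
    rcases B with _ | ⟨b, _ | ⟨c, _ | ⟨d, B⟩⟩⟩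
    · norm_num [offordBound, exitDeficit]
    · norm_num [offordBound, exitDeficit]
    · norm_num [offordBound, exitDeficit]
    · simp [offordBound, exitDeficit]
  | cons a l ih =>
    intro B N hB
    have key : ∀ s : ℝ, signExp (s :: (l ++ (B ++ N))) (ballInd t) 0 ≤ 3 / 8 +
        (if |s| < t then exitDeficit t l (3 - B.length) s
          else exitDeficit t l (3 - B.length - 1) 0) / 8 +
        (if |s| < t then exitDeficit t l (1 - B.length) s
          else exitDeficit t l (1 - B.length - 1) 0) / 2 := by
      intro s
      split_ifs with hs
      · exact ih s B N hB
      · have h := ih 0 (|s| :: B) N (by simpa using ⟨not_lt.1 hs, hB⟩)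
        have hp : (0 :: l ++ (|s| :: B ++ N)).Perm (0 :: |s| :: (l ++ (B ++ N))) :=
          List.Perm.cons _ List.perm_middle
        rw [signExp_perm hp, signExp_merge, zero_add, zero_sub, signExp_neg_cons,
          signExp_abs_cons] at h
        simp only [List.length_cons, Nat.sub_add_eq] at h
        linarith
    have h₁ := key (r + a)
    have h₂ := key (r - a)
    rw [List.cons_append, List.cons_append, signExp_merge]
    simp only [exitDeficit_cons t a l]
    linarith

/-- The sum of the squares of the entries of a list. -/
def sqSum (l : List ℝ) : ℝ := (l.map (· ^ 2)).sum

theorem sqSum_cons (a : ℝ) (l : List ℝ) : sqSum (a :: l) = a ^ 2 + sqSum l := by simp [sqSum]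

/-- Optional stopping for the squared walk: a restart costs at most `(t + δ) ^ 2`. -/
theorem exitDeficit_sq_bound {t δ : ℝ} (ht : 0 ≤ t) (l : List ℝ)
    (hl : ∀ a ∈ l, |a| ≤ δ) (k : ℕ) (r : ℝ) (hr : |r| ≤ t) :
    (sqSum l - t ^ 2 + (t + δ) ^ 2) * exitDeficit t l (k + 1) r +
      (t + δ) ^ 2 * ∑ j ∈ Finset.range (k + 1), exitDeficit t l j r ≤
        (k + 1) * (t + δ) ^ 2 - r ^ 2 := by
  induction l generalizing k r with
  | nil =>
    have hr2 : r ^ 2 ≤ t ^ 2 := sq_le_sq' (abs_le.1 hr).1 (abs_le.1 hr).2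
    rw [Finset.sum_range_succ']
    simp [exitDeficit, sqSum]
    linarith
  | cons a l ih =>
    have hl' : ∀ a ∈ l, |a| ≤ δ := fun b hb => hl b (by simp [hb])
    have ha : |a| ≤ δ := hl a (by simp)
    let v : ℕ → ℝ → ℝ := fun j s =>
      if |s| < t then exitDeficit t l j s else exitDeficit t l (j - 1) 0
    have key : ∀ s : ℝ, |s| ≤ t + δ →
        (sqSum l - t ^ 2 + (t + δ) ^ 2) * v (k + 1) s +
          (t + δ) ^ 2 * ∑ j ∈ Finset.range (k + 1), v j s ≤ (k + 1) * (t + δ) ^ 2 - s ^ 2 := by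
      intro s hs
      by_cases h : |s| < t
      · simp only [v, if_pos h]
        exact ih hl' k s h.le
      · simp only [v, if_neg h, Nat.add_sub_cancel]
        have hs2 : s ^ 2 ≤ (t + δ) ^ 2 := sq_le_sq' (by linarith [neg_abs_le s]) ((le_abs_self s).trans hs)
        rw [Finset.sum_range_succ']
        cases k with
        | zero => simp [exitDeficit_zero]; linarith
        | succ k =>
          have := ih hl' k 0 (by simpa using ht)
          simp only [Nat.add_sub_cancel, Nat.zero_sub, exitDeficit_zero] at this ⊢
          push_cast
          linarith
    have e : ∀ j, exitDeficit t (a :: l) j r = (v j (r + a) + v j (r - a)) / 2 :=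
      fun j => exitDeficit_cons t a l j r
    have h₁ := key (r + a) ((abs_add_le r a).trans (by linarith))
    have h₂ := key (r - a) ((abs_sub r a).trans (by linarith))
    have h₃ := exitDeficit_le_one t (a :: l) (k + 1) r
    have h₄ : a ^ 2 * exitDeficit t (a :: l) (k + 1) r ≤ a ^ 2 :=
      mul_le_of_le_one_right (sq_nonneg a) h₃
    rw [sqSum_cons]
    have h₅ : ∑ j ∈ Finset.range (k + 1), exitDeficit t (a :: l) j r =
        (∑ j ∈ Finset.range (k + 1), v j (r + a) + ∑ j ∈ Finset.range (k + 1), v j (r - a)) / 2 := by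
      rw [← Finset.sum_add_distrib, Finset.sum_div]
      exact Finset.sum_congr rfl fun j _ => e j
    rw [h₅]
    rw [e] at h₄ ⊢
    linarith

theorem cos_le_exp_of_abs_le {a : ℝ} (ha : |a| ≤ 7 / 20) :
    Real.cos (14 / 5 * a) ≤ Real.exp (-(7 / 2) * a ^ 2) := by
  have h₁ : |14 / 5 * a| ≤ 49 / 50 := by
    rw [abs_mul, abs_of_pos (by norm_num : (0 : ℝ) < 14 / 5)]; linarith
  have h₂ := (abs_le.1 (Real.cos_bound (h₁.trans (by norm_num)))).2
  have h₃ := Real.add_one_le_exp (-(7 / 2) * a ^ 2)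
  have h₄ : |14 / 5 * a| ^ 4 = (14 / 5 * a) ^ 4 := Even.pow_abs (by decide) _
  have h₅ : a ^ 2 ≤ (7 / 20) ^ 2 := sq_le_sq' (abs_le.1 ha).1 (abs_le.1 ha).2
  rw [h₄] at h₂
  nlinarith [sq_nonneg a, mul_le_mul_of_nonneg_left h₅ (sq_nonneg a)]

theorem half_le_cos_of_abs_le {r : ℝ} (hr : |r| ≤ 7 / 20) : 1 / 2 ≤ Real.cos (14 / 5 * r) := by
  rw [← Real.cos_abs, abs_mul, abs_of_pos (by norm_num : (0 : ℝ) < 14 / 5),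
    ← Real.cos_pi_div_three]
  have := Real.pi_gt_d2
  exact Real.cos_le_cos_of_nonneg_of_le_pi (by positivity) (by linarith) (by linarith)

/-- The cosine supermartingale bound for the probability of never leaving `(-7/20, 7/20)`. -/
theorem exitDeficit_one_le_exp (l : List ℝ) (hl : ∀ a ∈ l, |a| ≤ 7 / 40) (r : ℝ)
    (hr : |r| ≤ 7 / 20) :
    exitDeficit (7 / 20) l 1 r ≤
      2 * (Real.cos (14 / 5 * r) * Real.exp (-(7 / 2) * sqSum l)) := by
  induction l generalizing r with
  | nil =>
    simp [exitDeficit, sqSum]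
    linarith [half_le_cos_of_abs_le hr]
  | cons a l ih =>
    have ha : |a| ≤ 7 / 40 := hl a (by simp)
    have key : ∀ s : ℝ, |s| ≤ 21 / 40 →
        (if |s| < 7 / 20 then exitDeficit (7 / 20) l 1 s else exitDeficit (7 / 20) l (1 - 1) 0) ≤
          2 * (Real.cos (14 / 5 * s) * Real.exp (-(7 / 2) * sqSum l)) := by
      intro s hs
      split_ifs with h
      · exact ih (fun b hb => hl b (by simp [hb])) s h.le
      · rw [exitDeficit_zero]
        have := Real.pi_gt_d2
        have hs' := abs_le.1 hs
        have : 0 ≤ Real.cos (14 / 5 * s) :=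
          Real.cos_nonneg_of_mem_Icc ⟨by linarith, by linarith⟩
        positivity
    have h₁ := key (r + a) ((abs_add_le r a).trans (by linarith))
    have h₂ := key (r - a) ((abs_sub r a).trans (by linarith))
    have h₃ : Real.cos (14 / 5 * r) * Real.cos (14 / 5 * a) ≤
        Real.cos (14 / 5 * r) * Real.exp (-(7 / 2) * a ^ 2) :=
      mul_le_mul_of_nonneg_left (cos_le_exp_of_abs_le (ha.trans (by norm_num)))
        (by linarith [half_le_cos_of_abs_le hr])
    have h₄ := mul_le_mul_of_nonneg_right h₃ (Real.exp_nonneg (-(7 / 2) * sqSum l))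
    rw [exitDeficit_cons, sqSum_cons, mul_add (-(7 / 2) : ℝ), Real.exp_add]
    rw [mul_add, Real.cos_add] at h₁
    rw [mul_sub, Real.cos_sub] at h₂
    linarith

theorem exp_neg_seven_fourths_le : Real.exp (-(7 / 4)) ≤ 18 / 100 := by
  have h := Real.exp_one_gt_d9
  have h₁ : Real.exp (7 / 4) ^ 4 = Real.exp 1 ^ 7 := by
    rw [← Real.exp_nat_mul, ← Real.exp_nat_mul]; norm_num
  have h₂ : (2.7 : ℝ) ^ 7 ≤ Real.exp 1 ^ 7 := by gcongr; linarith
  rw [Real.exp_neg, inv_le_comm₀ (Real.exp_pos _) (by norm_num)]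
  refine le_of_pow_le_pow_left₀ (n := 4) (by norm_num) (Real.exp_nonneg _) ?_
  rw [h₁]
  exact le_trans (by norm_num) h₂

theorem exp_neg_five_halves_le : Real.exp (-(5 / 2)) ≤ 9 / 100 := by
  have h := Real.exp_one_gt_d9
  have h₁ : Real.exp (5 / 2) ^ 2 = Real.exp 1 ^ 5 := by
    rw [← Real.exp_nat_mul, ← Real.exp_nat_mul]; norm_num
  have h₂ : (2.7 : ℝ) ^ 5 ≤ Real.exp 1 ^ 5 := by gcongr; linarith
  rw [Real.exp_neg, inv_le_comm₀ (Real.exp_pos _) (by norm_num)]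
  refine le_of_pow_le_pow_left₀ (n := 2) (by norm_num) (Real.exp_nonneg _) ?_
  rw [h₁]
  exact le_trans (by norm_num) h₂

theorem exp_neg_seven_halves_le : Real.exp (-(7 / 2)) ≤ 33 / 1000 := by
  have h := exp_neg_seven_fourths_le
  rw [show (-(7 / 2) : ℝ) = -(7 / 4) + -(7 / 4) by norm_num, Real.exp_add]
  nlinarith [Real.exp_nonneg (-(7 / 4))]

/-- Bounds for the number of exits of a walk with variance `V` (including that of the starting
point) whose steps are small. -/
theorem exitDeficit_sq_bound_start {t δ : ℝ} (ht : 0 ≤ t) (l : List ℝ)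
    (hl : ∀ a ∈ l, |a| ≤ δ) (k : ℕ) (r : ℝ) (hr : |r| ≤ t) :
    (sqSum (r :: l) - t ^ 2 + (t + δ) ^ 2) * exitDeficit t l (k + 1) r +
      (t + δ) ^ 2 * ∑ j ∈ Finset.range (k + 1), exitDeficit t l j r ≤ (k + 1) * (t + δ) ^ 2 := by
  have h₁ := exitDeficit_sq_bound ht l hl k r hr
  have h₂ := mul_le_of_le_one_right (sq_nonneg r) (exitDeficit_le_one t l (k + 1) r)
  rw [sqSum_cons]
  linarith

theorem exitDeficit_linear_bounds {l : List ℝ} {r v : ℝ} (hl : ∀ a ∈ l, |a| ≤ 7 / 40)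
    (hr : |r| ≤ 7 / 20) (hv : v ≤ sqSum (r :: l)) :
    (v + 49 / 320) * exitDeficit (7 / 20) l 2 r + 441 / 1600 * exitDeficit (7 / 20) l 1 r ≤
        441 / 800 ∧
      (v + 49 / 320) * exitDeficit (7 / 20) l 3 r + 441 / 1600 *
        (exitDeficit (7 / 20) l 1 r + exitDeficit (7 / 20) l 2 r) ≤ 1323 / 1600 ∧
      exitDeficit (7 / 20) l 1 r ≤ 2 * Real.exp (-(7 / 2) * v) := by
  have h₂ := exitDeficit_sq_bound_start (by norm_num) l hl 1 r hr
  have h₃ := exitDeficit_sq_bound_start (by norm_num) l hl 2 r hr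
  norm_num [Finset.sum_range_succ, exitDeficit_zero] at h₂ h₃
  have m₂ := mul_le_mul_of_nonneg_right hv (exitDeficit_nonneg (7 / 20) l 2 r)
  have m₃ := mul_le_mul_of_nonneg_right hv (exitDeficit_nonneg (7 / 20) l 3 r)
  refine ⟨by linarith, by linarith, (exitDeficit_one_le_exp l hl r hr).trans ?_⟩
  have h₄ := mul_le_mul_of_nonneg_right (cos_le_exp_of_abs_le hr)
    (Real.exp_nonneg (-(7 / 2) * sqSum l))
  rw [← Real.exp_add, ← mul_add, ← sqSum_cons] at h₄
  have h₅ : Real.exp (-(7 / 2) * sqSum (r :: l)) ≤ Real.exp (-(7 / 2) * v) :=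
    Real.exp_le_exp.2 (by linarith)
  linarith

theorem exists_cons_cons_of_sqSum {M : List ℝ} (h : ∀ a ∈ M, 0 ≤ a ∧ a < 7 / 20)
    (hM : 1 / 4 ≤ sqSum M) : ∃ a b l, M = a :: b :: l := by
  match M with
  | [] => norm_num [sqSum] at hM
  | [a] =>
    have := h a (by simp)
    simp [sqSum] at hM
    nlinarith
  | a :: b :: l => exact ⟨a, b, l, rfl⟩

theorem signExp_ballInd_le_half_of_pairwise {L : List ℝ} (hs : L.Pairwise (· ≥ ·))
    (h0 : ∀ a ∈ L, 0 ≤ a) (hV : sqSum L = 1) : signExp L (ballInd (7 / 20)) 0 ≤ 1 / 2 := by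
  by_cases hlt : ∀ a ∈ L, a < 7 / 20
  swap
  · push Not at hlt
    obtain ⟨b, hb, hbt⟩ := hlt
    rw [signExp_perm (List.perm_cons_erase hb)]
    exact signExp_ballInd_cons_le hbt _ _
  have ht : (0 : ℝ) ≤ 7 / 20 := by norm_num
  have hmem : ∀ a ∈ L, 0 ≤ a ∧ a < 7 / 20 := fun a ha => ⟨h0 a ha, hlt a ha⟩
  clear h0 hlt
  have of_bound : ∀ w : ℕ → ℝ, IsSmallBallBound (7 / 20) L w → w 0 ≤ 1 / 2 →
      signExp L (ballInd (7 / 20)) 0 ≤ 1 / 2 := fun w hw hw0 => by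
    have := hw [] [] (by simp)
    simp only [List.append_nil, List.length_nil] at this
    exact this.trans hw0
  have small : ∀ (a b : ℝ) (l : List ℝ), (a :: b :: l).Pairwise (· ≥ ·) → (∀ c ∈ a :: b :: l, 0 ≤ c ∧ c < 7 / 20) →
      a + b < 7 / 20 → (∀ c ∈ b :: l, |c| ≤ b) ∧ (∀ c ∈ b :: l, |c| ≤ 7 / 40) ∧ |a| ≤ 7 / 20 := by
    intro a b l hp hm hab
    simp only [List.pairwise_cons, List.mem_cons, forall_eq_or_imp] at hp hm
    obtain ⟨⟨hba, -⟩, hb, -⟩ := hp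
    obtain ⟨ha, hb0, hl0⟩ := hm
    have h : ∀ c ∈ b :: l, |c| ≤ b := by
      intro c hc
      rcases List.mem_cons.1 hc with rfl | hc
      · exact (abs_of_nonneg hb0.1).le
      · rw [abs_of_nonneg (hl0 c hc).1]; exact hb c hc
    exact ⟨h, fun c hc => (h c hc).trans (by linarith), by rw [abs_of_nonneg ha.1]; exact ha.2.le⟩
  have sq_lt : ∀ a : ℝ, 0 ≤ a ∧ a < 7 / 20 → a ^ 2 ≤ 49 / 400 := fun a ha => by nlinarith
  obtain ⟨a₁, a₂, M₁, rfl⟩ := exists_cons_cons_of_sqSum hmem (by linarith)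
  by_cases p₁ : a₁ + a₂ < 7 / 20
  · obtain ⟨-, hl, hr⟩ := small _ _ _ hs hmem p₁
    obtain ⟨e₂, e₃, e₁⟩ := exitDeficit_linear_bounds hl hr hV.ge
    refine of_bound _ (isSmallBallBound_exitDeficit ht _ _) ?_
    have n₂ := exitDeficit_nonneg (7 / 20) (a₂ :: M₁) 2 a₁
    have hE := exp_neg_seven_halves_le
    norm_num at e₁ ⊢
    linarith
  rw [not_lt] at p₁
  have hs₁ := hs.of_cons.of_cons
  have hm₁ : ∀ a ∈ M₁, 0 ≤ a ∧ a < 7 / 20 := fun a ha => hmem a (by simp [ha])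
  have hV₁ : 151 / 200 ≤ sqSum M₁ := by
    rw [sqSum_cons, sqSum_cons] at hV
    linarith [sq_lt a₁ (hmem a₁ (by simp)), sq_lt a₂ (hmem a₂ (by simp))]
  obtain ⟨a₃, a₄, M₂, rfl⟩ := exists_cons_cons_of_sqSum hm₁ (by linarith)
  by_cases p₂ : a₃ + a₄ < 7 / 20
  · obtain ⟨-, hl, hr⟩ := small _ _ _ hs₁ hm₁ p₂
    obtain ⟨e₂, e₃, e₁⟩ := exitDeficit_linear_bounds hl hr hV₁
    refine of_bound _ ((isSmallBallBound_exitDeficit ht _ _).pair p₁) ?_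
    have hE : Real.exp (-(7 / 2) * (151 / 200)) ≤ 9 / 100 :=
      (Real.exp_le_exp.2 (by norm_num)).trans exp_neg_five_halves_le
    replace e₁ := e₁.trans (mul_le_mul_of_nonneg_left hE zero_le_two)
    norm_num [exitDeficit_zero] at e₁ e₂ e₃ ⊢
    linarith
  rw [not_lt] at p₂
  have hs₂ := hs₁.of_cons.of_cons
  have hm₂ : ∀ a ∈ M₂, 0 ≤ a ∧ a < 7 / 20 := fun a ha => hm₁ a (by simp [ha])
  have hV₂ : 51 / 100 ≤ sqSum M₂ := by
    rw [sqSum_cons, sqSum_cons] at hV₁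
    linarith [sq_lt a₃ (hm₁ a₃ (by simp)), sq_lt a₄ (hm₁ a₄ (by simp))]
  obtain ⟨a₅, a₆, M₃, rfl⟩ := exists_cons_cons_of_sqSum hm₂ (by linarith)
  by_cases p₃ : a₅ + a₆ < 7 / 20
  · obtain ⟨-, hl, hr⟩ := small _ _ _ hs₂ hm₂ p₃
    obtain ⟨e₂, e₃, e₁⟩ := exitDeficit_linear_bounds hl hr hV₂
    refine of_bound _ (((isSmallBallBound_exitDeficit ht _ _).pair p₂).pair p₁) ?_
    have hE : Real.exp (-(7 / 2) * (51 / 100)) ≤ 18 / 100 :=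
      (Real.exp_le_exp.2 (by norm_num)).trans exp_neg_seven_fourths_le
    replace e₁ := e₁.trans (mul_le_mul_of_nonneg_left hE zero_le_two)
    norm_num [exitDeficit_zero] at e₁ e₂ e₃ ⊢
    linarith
  rw [not_lt] at p₃
  have hs₃ := hs₂.of_cons.of_cons
  have hm₃ : ∀ a ∈ M₃, 0 ≤ a ∧ a < 7 / 20 := fun a ha => hm₂ a (by simp [ha])
  have b₅ := hm₂ a₅ (by simp)
  have b₆ := hm₂ a₆ (by simp)
  have hV₃ : 51 / 100 ≤ a₅ ^ 2 + a₆ ^ 2 + sqSum M₃ := by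
    rw [sqSum_cons, sqSum_cons] at hV₂
    linarith
  obtain ⟨a₇, a₈, M₄, rfl⟩ := exists_cons_cons_of_sqSum hm₃
    (by linarith [sq_lt a₅ b₅, sq_lt a₆ b₆])
  have w4 : ((((((offordBound 4 + offordBound 3) / 2 + (offordBound 3 + offordBound 2) / 2) / 2 +
      ((offordBound 3 + offordBound 2) / 2 + (offordBound 2 + offordBound 1) / 2) / 2) / 2) +
      ((((offordBound 3 + offordBound 2) / 2 + (offordBound 2 + offordBound 1) / 2) / 2 +
      ((offordBound 2 + offordBound 1) / 2 + (offordBound 1 + offordBound 0) / 2) / 2) / 2)) / 2)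
      ≤ (1 / 2 : ℝ) := by norm_num [offordBound]
  have hoff := isSmallBallBound_offordBound ht M₄
  by_cases p₄ : 7 / 20 ≤ a₇ + a₈
  · exact of_bound _ ((((hoff.pair p₄).pair p₃).pair p₂).pair p₁) w4
  rw [not_le] at p₄
  simp only [List.pairwise_cons, List.mem_cons, forall_eq_or_imp] at hs₂
  by_cases q : 7 / 20 ≤ a₆ + a₈
  · have hp : (a₁ :: a₂ :: a₃ :: a₄ :: a₅ :: a₆ :: a₇ :: a₈ :: M₄).Perm
        (a₁ :: a₂ :: a₃ :: a₄ :: a₅ :: a₇ :: a₆ :: a₈ :: M₄) := by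
      iterate 5 refine List.Perm.cons _ ?_
      exact List.Perm.swap _ _ _
    rw [signExp_perm hp]
    have := ((((hoff.pair q).pair (show 7 / 20 ≤ a₅ + a₇ by linarith)).pair p₂).pair p₁)
      [] [] (by simp)
    simp only [List.append_nil, List.length_nil] at this
    exact this.trans w4
  rw [not_le] at q
  obtain ⟨hl, hl', hr⟩ := small _ _ _ hs₃ hm₃ p₄
  have e₁ := exitDeficit_sq_bound_start ht _ hl 0 a₇ hr
  have n₁ := exitDeficit_nonneg (7 / 20) (a₈ :: M₄) 1 a₇
  have b₈ := hm₃ a₈ (by simp)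
  have hV₄ : 53 / 200 + 7 / 10 * a₈ - a₈ ^ 2 ≤ sqSum (a₇ :: a₈ :: M₄) := by
    have := sq_lt a₅ b₅
    have : a₆ ^ 2 ≤ (7 / 20 - a₈) ^ 2 := sq_le_sq' (by linarith) (by linarith)
    linarith
  have u₁ : exitDeficit (7 / 20) (a₈ :: M₄) 1 a₇ ≤ 4 / 7 := by
    norm_num [exitDeficit_zero] at e₁
    have h := mul_le_mul_of_nonneg_right hV₄ n₁
    have hD : 0 < 53 / 200 + 7 / 5 * a₈ := by linarith
    refine le_of_mul_le_mul_left (a := 53 / 200 + 7 / 5 * a₈) ?_ hD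
    have ha : a₈ ≤ 7 / 40 := (le_abs_self a₈).trans (hl' a₈ (by simp))
    nlinarith
  refine of_bound _ ((((isSmallBallBound_exitDeficit ht _ _).pair p₃).pair p₂).pair p₁) ?_
  have u₂ := exitDeficit_le_one (7 / 20) (a₈ :: M₄) 2 a₇
  have u₃ := exitDeficit_le_one (7 / 20) (a₈ :: M₄) 3 a₇
  norm_num [exitDeficit_zero]
  linarith

theorem signExp_ballInd_le_half (l : List ℝ) (hV : sqSum l = 1) :
    signExp l (ballInd (7 / 20)) 0 ≤ 1 / 2 := by
  have hp := List.perm_insertionSort (· ≥ ·) (l.map fun a => |a|)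
  rw [← signExp_map_abs, ← signExp_perm hp]
  refine signExp_ballInd_le_half_of_pairwise (List.pairwise_insertionSort _ _) ?_ ?_
  · intro a ha
    obtain ⟨b, -, rfl⟩ := List.mem_map.1 (hp.mem_iff.1 ha)
    exact abs_nonneg b
  · rw [sqSum, (hp.map _).sum_eq, List.map_map, ← hV, sqSum]
    congr 2
    ext a
    simp

theorem signExp_ofFn {n : ℕ} (a : Fin n → ℝ) (f : ℝ → ℝ) (x : ℝ) :
    signExp (List.ofFn a) f x =
      (∑ ε : Fin n → Bool, f (x + ∑ i, a i * (if ε i then (1 : ℝ) else -1))) / 2 ^ n := by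
  induction n generalizing x with
  | zero => simp [signExp]
  | succ n ih =>
    rw [List.ofFn_succ, signExp, ih, ih,
      ← (Fin.consEquiv fun _ : Fin (n + 1) => Bool).sum_comp, Fintype.sum_prod_type]
    simp [Fin.consEquiv, Fin.sum_univ_succ, pow_succ, ← add_assoc, ← sub_eq_add_neg]
    field_simp

open scoped Classical in
theorem radProb_eq_signExp {n : ℕ} (a : Fin n → ℝ) (p : ℝ → Prop) :
    radProb a p = signExp (List.ofFn a) (fun x => if p x then 1 else 0) 0 := by
  rw [signExp_ofFn, radProb, Nat.card_eq_fintype_card, Fintype.card_fin, Fintype.card_subtype]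
  simp [Finset.sum_boole]

theorem rademacher_ge_const_mul_stddev (n : ℕ) (hn : 0 < n) (a : Fin n → ℝ)
    (hvar : 0 < ∑ i, (a i) ^ 2) :
    radProb a (fun x => x ≥ 0.35 * Real.sqrt (∑ i, (a i) ^ 2)) ≥ 1 / 4 := by
  classical
  set σ := Real.sqrt (∑ i, (a i) ^ 2) with hσ
  have hσ0 : 0 < σ := Real.sqrt_pos.2 hvar
  have hσ2 : σ ^ 2 = ∑ i, (a i) ^ 2 := Real.sq_sqrt hvar.le
  let l := (List.ofFn a).map fun y => σ⁻¹ * y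
  let f : ℝ → ℝ := fun y => if 7 / 20 ≤ y then 1 else 0
  have hV : sqSum l = 1 := by
    simp only [l, sqSum, List.map_ofFn, List.sum_ofFn, Function.comp, mul_pow]
    rw [← Finset.mul_sum, ← hσ2, ← mul_pow, inv_mul_cancel₀ hσ0.ne', one_pow]
  have h₁ : radProb a (fun x => x ≥ 0.35 * σ) = signExp l f 0 := by
    have := signExp_map_mul σ⁻¹ (List.ofFn a) f 0
    rw [mul_zero] at this
    rw [this, radProb_eq_signExp]
    congr 1
    ext y
    refine if_congr ?_ rfl rfl
    rw [inv_mul_eq_div, le_div_iff₀ hσ0]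
    norm_num
  have h₂ : (fun y => f y + f (-y) + ballInd (7 / 20) y) = fun _ => 1 := by
    ext y
    simp only [f, ballInd, abs_lt]
    split_ifs <;> grind
  have h₃ := signExp_const l 1 0
  rw [← h₂, signExp_add l (fun y => f y + f (-y)), signExp_add l f, signExp_comp_neg,
    neg_zero] at h₃
  rw [h₁]
  linarith [signExp_ballInd_le_half l hV]
end

section
/- Let s, γ, d be real numbers with 0 < γ < d/2, and let X = Y + Z, where Y and Z are independent random variables and Z is a finite Rademacher sum with Var(Z) ≥ 8.17 γ². For each integer r define p_r = P(Y ∈ [s + r·d − γ, s + r·d + γ]), and let t = Σ_{r=2}^∞ p_r. If p_{-1} ≥ t and p_0 ≥ p_1, then P(X ≥ s) ≥ p_0/4 + 3 p_1/4 + t. -/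
open MeasureTheory ProbabilityTheory

/-- The distribution on `ℝ` of the finite Rademacher sum with weights `b`:
the pushforward of the uniform distribution on sign vectors under the weighted sum. -/
noncomputable def radMeasure (m : ℕ) (b : Fin m → ℝ) : Measure ℝ :=
  Measure.map (fun ε : Fin m → Bool => ∑ i, b i * (if ε i then (1 : ℝ) else -1))
    (PMF.uniformOfFintype (Fin m → Bool)).toMeasure

/-- The sum of the weights `b` with the signs `ε`, where `true` stands for `+1`. -/
noncomputable def signedSum {ι : Type*} [Fintype ι] (b : ι → ℝ) (ε : ι → Bool) : ℝ :=
  ∑ i, b i * (if ε i then (1 : ℝ) else -1)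

theorem cos_le_exp_neg_sq_div_two {x : ℝ} (hx : |x| ≤ Real.pi / 2) :
    Real.cos x ≤ Real.exp (-(x ^ 2 / 2)) := by
  wlog h0 : 0 ≤ x generalizing x
  · have := this (x := -x) (by rwa [abs_neg]) (by linarith)
    simpa using this
  rw [abs_of_nonneg h0] at hx
  have hanti : AntitoneOn (fun y => Real.cos y * Real.exp (y ^ 2 / 2))
      (Set.Icc 0 (Real.pi / 2)) := by
    have hd : ∀ y : ℝ, HasDerivAt (fun y => Real.cos y * Real.exp (y ^ 2 / 2))
        ((y * Real.cos y - Real.sin y) * Real.exp (y ^ 2 / 2)) y := by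
      intro y
      have h := (Real.hasDerivAt_cos y).mul (((hasDerivAt_pow 2 y).div_const 2).exp)
      refine h.congr_deriv ?_
      push_cast
      ring
    refine antitoneOn_of_deriv_nonpos (convex_Icc _ _) (by fun_prop)
      (fun y _ => (hd y).differentiableAt.differentiableWithinAt) ?_
    intro y hy
    rw [interior_Icc] at hy
    rw [(hd y).deriv]
    have hc : 0 < Real.cos y := Real.cos_pos_of_mem_Ioo ⟨by linarith [hy.1, Real.pi_pos], hy.2⟩
    have ht := Real.lt_tan hy.1 hy.2
    rw [Real.tan_eq_sin_div_cos, lt_div_iff₀ hc] at ht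
    exact mul_nonpos_of_nonpos_of_nonneg (by linarith) (Real.exp_pos _).le
  have h := hanti ⟨le_rfl, by positivity⟩ ⟨h0, hx⟩ h0
  simp only [Real.cos_zero, ne_eq, OfNat.ofNat_ne_zero, not_false_eq_true, zero_pow, zero_div,
    Real.exp_zero, mul_one] at h
  rw [Real.exp_neg, ← one_div, le_div_iff₀ (Real.exp_pos _)]
  exact h

theorem sum_cos_signedSum {ι : Type*} [Fintype ι] [DecidableEq ι] (b : ι → ℝ) (u : ℝ) :
    ∑ ε : ι → Bool, Real.cos (u * signedSum b ε) =
      2 ^ Fintype.card ι * ∏ i, Real.cos (u * b i) := by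
  have key : ∑ ε : ι → Bool, Complex.exp ((u * signedSum b ε : ℝ) * Complex.I) =
      ((2 ^ Fintype.card ι * ∏ i, Real.cos (u * b i) : ℝ) : ℂ) := by
    have h1 : ∀ ε : ι → Bool, Complex.exp ((u * signedSum b ε : ℝ) * Complex.I) =
        ∏ i, Complex.exp ((u * (b i * (if ε i then (1 : ℝ) else -1)) : ℝ) * Complex.I) := by
      intro ε
      rw [← Complex.exp_sum, ← Finset.sum_mul, ← Complex.ofReal_sum, ← Finset.mul_sum]
      rfl
    simp_rw [h1]
    rw [← Fintype.prod_sum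
      (fun i (e : Bool) =>
        Complex.exp ((u * (b i * (if e then (1 : ℝ) else -1)) : ℝ) * Complex.I))]
    push_cast
    rw [← Finset.card_univ, ← Finset.prod_const, ← Finset.prod_mul_distrib]
    refine Finset.prod_congr rfl fun i _ => ?_
    simp [Complex.two_cos]
  have := congrArg Complex.re key
  rw [Complex.re_sum, Complex.ofReal_re] at this
  simpa only [Complex.exp_ofReal_mul_I_re] using this

theorem abs_prod_cos_le_exp {ι : Type*} [Fintype ι] (s : Finset ι) (b : ι → ℝ) (u : ℝ)
    (hb : ∀ i ∈ s, |u * b i| ≤ Real.pi / 2) :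
    |∏ i, Real.cos (u * b i)| ≤ Real.exp (-(u ^ 2 * (∑ i ∈ s, b i ^ 2) / 2)) := by
  classical
  rw [Finset.abs_prod]
  calc ∏ i, |Real.cos (u * b i)| ≤ ∏ i ∈ s, |Real.cos (u * b i)| := by
        rw [← Finset.prod_mul_prod_compl s]
        exact mul_le_of_le_one_right (Finset.prod_nonneg fun i _ => abs_nonneg _)
          (Finset.prod_le_one (fun i _ => abs_nonneg _) fun i _ => Real.abs_cos_le_one _)
    _ ≤ ∏ i ∈ s, Real.exp (-((u * b i) ^ 2 / 2)) := by
        refine Finset.prod_le_prod (fun i _ => abs_nonneg _) fun i hi => ?_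
        rw [abs_of_nonneg (Real.cos_nonneg_of_mem_Icc
          ⟨by linarith [(abs_le.mp (hb i hi)).1], (abs_le.mp (hb i hi)).2⟩)]
        exact cos_le_exp_neg_sq_div_two (hb i hi)
    _ = _ := by
        rw [← Real.exp_sum]
        congr 1
        rw [Finset.mul_sum, Finset.sum_div, ← Finset.sum_neg_distrib]
        exact Finset.sum_congr rfl fun i _ => by ring

theorem cos_majorant_nonneg (θ : ℝ) :
    0 ≤ 0.435 + 0.58 * Real.cos θ + 0.19 * Real.cos (2 * θ) - 0.075 * Real.cos (3 * θ)
      - 0.115 * Real.cos (4 * θ) := by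
  have h4 : Real.cos (4 * θ) = 2 * Real.cos (2 * θ) ^ 2 - 1 := by
    rw [← Real.cos_two_mul, ← mul_assoc]; norm_num
  rw [h4, Real.cos_three_mul, Real.cos_two_mul]
  have h1 := Real.cos_le_one θ
  have h2 := Real.neg_one_le_cos θ
  set y := Real.cos θ
  have hq : 0 ≤ (y + 0.32) ^ 2 * (1.2088 - 0.92 * y) :=
    mul_nonneg (sq_nonneg _) (by linarith)
  have hr : 0 ≤ -0.92 * y ^ 3 + 0.62 * y ^ 2 + 0.68 * y + 0.125 := by nlinarith
  nlinarith [mul_nonneg (by linarith : 0 ≤ y + 1) hr]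

theorem one_le_cos_majorant {θ : ℝ} (hθ : |θ| ≤ Real.pi / 4) :
    1 ≤ 0.435 + 0.58 * Real.cos θ + 0.19 * Real.cos (2 * θ) - 0.075 * Real.cos (3 * θ)
      - 0.115 * Real.cos (4 * θ) := by
  have h4 : Real.cos (4 * θ) = 2 * Real.cos (2 * θ) ^ 2 - 1 := by
    rw [← Real.cos_two_mul, ← mul_assoc]; norm_num
  have h2 : 0 ≤ Real.cos (2 * θ) := by
    rw [abs_le] at hθ
    exact Real.cos_nonneg_of_mem_Icc ⟨by linarith, by linarith⟩
  have h0 : 0 ≤ Real.cos θ := by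
    rw [abs_le] at hθ
    exact Real.cos_nonneg_of_mem_Icc ⟨by linarith [Real.pi_pos], by linarith [Real.pi_pos]⟩
  rw [h4, Real.cos_three_mul]
  rw [Real.cos_two_mul] at h2 ⊢
  have h1 := Real.cos_le_one θ
  set y := Real.cos θ
  have h3 : 0.7 ≤ y := by nlinarith
  have hc : -0.01 ≤ 0.92 * y ^ 3 + 1.22 * y ^ 2 - 0.08 * y - 0.885 := by
    nlinarith [mul_nonneg h0 h2]
  nlinarith [mul_nonneg (by linarith : 0 ≤ 1 - y)
    (by linarith : 0 ≤ 0.92 * y ^ 3 + 1.22 * y ^ 2 - 0.08 * y - 0.885 + 0.01)]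

theorem sum_cos_mul_signedSum_le {ι : Type*} [Fintype ι] [DecidableEq ι] (s : Finset ι)
    (b : ι → ℝ) (u v c : ℝ) (hb : ∀ i ∈ s, |u * b i| ≤ Real.pi / 2)
    (hv : v ≤ u ^ 2 * (∑ i ∈ s, b i ^ 2) / 2) (hc : Real.exp (-v) ≤ c) :
    |∑ ε : ι → Bool, Real.cos (u * signedSum b ε)| ≤ 2 ^ Fintype.card ι * c := by
  rw [sum_cos_signedSum, abs_mul, abs_of_pos (by positivity)]
  gcongr
  exact (abs_prod_cos_le_exp s b u hb).trans
    ((Real.exp_le_exp.mpr (neg_le_neg hv)).trans hc)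

/-- If every weight is below `γ` and at most seven are at least `γ / 2`, a large variance forces
`|signedSum b ε| < γ` for at most half of the sign vectors. The indicator of `|x| < γ` is majorized
by a trigonometric polynomial of period `8 * γ`, whose mean is controlled by products of cosines. -/
theorem two_mul_card_abs_lt_le_of_few_large {ι : Type*} [Fintype ι] [DecidableEq ι]
    (b : ι → ℝ) {γ : ℝ} (hγ : 0 < γ) (hb : ∀ i, |b i| < γ)
    (hlarge : (Finset.univ.filter fun i => γ / 2 ≤ |b i|).card ≤ 7)
    (hvar : 8.17 * γ ^ 2 ≤ ∑ i, b i ^ 2) :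
    2 * (Finset.univ.filter fun ε : ι → Bool => |signedSum b ε| < γ).card ≤
      2 ^ Fintype.card ι := by
  set u : ℝ := Real.pi / (4 * γ) with hu
  have hu0 : 0 < u := by positivity
  have huγ : u * γ = Real.pi / 4 := by rw [hu]; field_simp
  have hpi := Real.pi_gt_d2
  have hsmall : 1.17 * γ ^ 2 ≤ ∑ i ∈ Finset.univ.filter (fun i => ¬ γ / 2 ≤ |b i|), b i ^ 2 := by
    have hsplit := Finset.sum_filter_add_sum_filter_not Finset.univ
      (fun i => γ / 2 ≤ |b i|) (fun i => b i ^ 2)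
    have h7 : ∑ i ∈ Finset.univ.filter (fun i => γ / 2 ≤ |b i|), b i ^ 2 ≤ 7 * γ ^ 2 := by
      refine (Finset.sum_le_card_nsmul _ _ (γ ^ 2) fun i _ => ?_).trans ?_
      · exact sq_le_sq' (by linarith [(abs_lt.mp (hb i)).1]) (abs_lt.mp (hb i)).2.le
      · rw [nsmul_eq_mul]
        gcongr
        exact_mod_cast hlarge
    linarith
  have hu2 : u ^ 2 * γ ^ 2 = Real.pi ^ 2 / 16 := by rw [← mul_pow, huγ]; ring
  have hpi2 : 9.85 ≤ Real.pi ^ 2 := by nlinarith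
  have he := Real.exp_one_gt_d9
  have hexp : ∀ v c : ℝ, 0 < c → c⁻¹ ≤ Real.exp v → Real.exp (-v) ≤ c := fun v c hc h => by
    rw [Real.exp_neg]
    exact inv_le_of_inv_le₀ hc h
  have hpow : ∀ n : ℕ, (2.718 : ℝ) ^ n ≤ Real.exp n := fun n => by
    rw [← mul_one (n : ℝ), Real.exp_nat_mul]
    gcongr
    linarith
  have hfreq : ∀ k r : ℝ, 0 ≤ k → k * r ≤ 2 * γ → ∀ x : ℝ, |x| ≤ r →
      |k * u * x| ≤ Real.pi / 2 := fun k r hk hr x hx => by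
    rw [abs_mul, abs_of_nonneg (by positivity)]
    calc k * u * |x| ≤ k * u * r := by gcongr
      _ = u * (k * r) := by ring
      _ ≤ u * (2 * γ) := by gcongr
      _ = Real.pi / 2 := by linarith
  have hv : ∀ k v w : ℝ, ∀ s : Finset ι, w * γ ^ 2 ≤ ∑ i ∈ s, b i ^ 2 →
      v ≤ k ^ 2 * w * (Real.pi ^ 2 / 32) → v ≤ (k * u) ^ 2 * (∑ i ∈ s, b i ^ 2) / 2 :=
    fun k v w s hs h => by
      have : (k * u) ^ 2 * (w * γ ^ 2) ≤ (k * u) ^ 2 * ∑ i ∈ s, b i ^ 2 := by gcongr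
      have h' : (k * u) ^ 2 * (w * γ ^ 2) = k ^ 2 * w * (Real.pi ^ 2 / 16) := by
        rw [← hu2]; ring
      linarith
  have B1 := sum_cos_mul_signedSum_le Finset.univ b (1 * u) 2.5 0.095
    (fun i _ => hfreq 1 γ (by norm_num) (by linarith) _ (hb i).le)
    (hv 1 _ _ _ hvar (by linarith)) (hexp _ _ (by norm_num) (by
      have h2 := hpow 2
      have h5 := Real.add_one_le_exp (0.5 : ℝ)
      rw [show (2.5 : ℝ) = (2 : ℕ) + 0.5 by norm_num, Real.exp_add]
      refine le_trans (by norm_num) (mul_le_mul h2 h5 (by norm_num) (Real.exp_pos _).le)))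
  have B2 := sum_cos_mul_signedSum_le Finset.univ b (2 * u) (5 : ℕ) 0.01
    (fun i _ => hfreq 2 γ (by norm_num) (by linarith) _ (hb i).le)
    (hv 2 _ _ _ hvar (by push_cast; linarith))
    (hexp _ _ (by norm_num) (le_trans (by norm_num) (hpow 5)))
  have B3 := sum_cos_mul_signedSum_le _ b (3 * u) (3 : ℕ) 0.05
    (fun i hi => hfreq 3 (γ / 2) (by norm_num) (by linarith) _
      (not_le.mp (Finset.mem_filter.mp hi).2).le)
    (hv 3 _ _ _ hsmall (by push_cast; linarith))
    (hexp _ _ (by norm_num) (le_trans (by norm_num) (hpow 3)))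
  have B4 := sum_cos_mul_signedSum_le _ b (4 * u) (5 : ℕ) 0.01
    (fun i hi => hfreq 4 (γ / 2) (by norm_num) (by linarith) _
      (not_le.mp (Finset.mem_filter.mp hi).2).le)
    (hv 4 _ _ _ hsmall (by push_cast; linarith))
    (hexp _ _ (by norm_num) (le_trans (by norm_num) (hpow 5)))
  have hmaj : ((Finset.univ.filter fun ε : ι → Bool => |signedSum b ε| < γ).card : ℝ) ≤
      ∑ ε : ι → Bool, (0.435 + 0.58 * Real.cos (1 * u * signedSum b ε) +
        0.19 * Real.cos (2 * u * signedSum b ε) - 0.075 * Real.cos (3 * u * signedSum b ε) -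
        0.115 * Real.cos (4 * u * signedSum b ε)) := by
    rw [Finset.card_filter, Nat.cast_sum]
    refine Finset.sum_le_sum fun ε _ => ?_
    simp only [one_mul, mul_assoc]
    split_ifs with h
    · rw [Nat.cast_one]
      refine one_le_cos_majorant ?_
      rw [abs_mul, abs_of_pos hu0, ← huγ]
      gcongr
    · rw [Nat.cast_zero]
      exact cos_majorant_nonneg _
  simp only [Finset.sum_add_distrib, Finset.sum_sub_distrib, ← Finset.mul_sum,
    Finset.sum_const, Finset.card_univ, Fintype.card_fun, Fintype.card_bool, nsmul_eq_mul] at hmaj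
  push_cast at hmaj
  rw [abs_le] at B1 B2 B3 B4
  have hpos : (0 : ℝ) < 2 ^ Fintype.card ι := by positivity
  have : 2 * ((Finset.univ.filter fun ε : ι → Bool => |signedSum b ε| < γ).card : ℝ) ≤
      2 ^ Fintype.card ι := by
    linarith [B1.2, B2.2, B3.1, B4.1]
  exact_mod_cast this

/-- Two disjoint antichains on eight points have at most `70 + 56` members. -/
theorem card_le_of_disjoint_antichains {α : Type*} [Fintype α] [DecidableEq α]
    (hα : Fintype.card α = 8) {𝒜 ℬ : Finset (Finset α)} (hdisj : Disjoint 𝒜 ℬ)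
    (hA : IsAntichain (· ⊆ ·) (𝒜 : Set (Finset α)))
    (hB : IsAntichain (· ⊆ ·) (ℬ : Set (Finset α))) : (𝒜 ∪ ℬ).card ≤ 126 := by
  have lymA := Finset.lubell_yamamoto_meshalkin_inequality_sum_card_div_choose (𝕜 := ℚ) hA
  have lymB := Finset.lubell_yamamoto_meshalkin_inequality_sum_card_div_choose (𝕜 := ℚ) hB
  have sumA := Finset.sum_card_slice 𝒜
  have sumB := Finset.sum_card_slice ℬ
  have hmid : (𝒜.slice 4).card + (ℬ.slice 4).card ≤ 70 := by
    rw [← Finset.card_union_of_disjoint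
      (Finset.disjoint_of_subset_left Finset.slice_subset
        (Finset.disjoint_of_subset_right Finset.slice_subset hdisj))]
    refine (Finset.card_le_card (t := Finset.powersetCard 4 Finset.univ) ?_).trans ?_
    · intro A hA
      rw [Finset.mem_union, Finset.mem_slice, Finset.mem_slice] at hA
      rw [Finset.mem_powersetCard_univ]
      rcases hA with h | h <;> exact h.2
    · rw [Finset.card_powersetCard, Finset.card_univ, hα]
      decide
  have hI : Finset.Iic 8 = Finset.range 9 := by decide
  rw [hα] at lymA lymB sumA sumB
  rw [hI] at sumA sumB
  rw [Finset.card_union_of_disjoint hdisj, ← sumA, ← sumB]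
  have c1 : Nat.choose 8 1 = 8 := by decide
  have c2 : Nat.choose 8 2 = 28 := by decide
  have c3 : Nat.choose 8 3 = 56 := by decide
  have c4 : Nat.choose 8 4 = 70 := by decide
  have c5 : Nat.choose 8 5 = 56 := by decide
  have c6 : Nat.choose 8 6 = 28 := by decide
  have c7 : Nat.choose 8 7 = 8 := by decide
  have c8 : Nat.choose 8 8 = 1 := by decide
  simp only [Finset.sum_range_succ, Finset.sum_range_zero, Nat.choose_zero_right, c1, c2, c3, c4,
    c5, c6, c7, c8] at lymA lymB ⊢
  have key : ∀ r, (0 : ℚ) ≤ (𝒜.slice r).card + (ℬ.slice r).card := fun r => by positivity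
  have hmid' : ((𝒜.slice 4).card + (ℬ.slice 4).card : ℚ) ≤ 70 := by exact_mod_cast hmid
  rw [← Nat.cast_le (α := ℚ)]
  push_cast at lymA lymB ⊢
  linarith [key 0, key 1, key 2, key 3, key 5, key 6, key 7, key 8]

theorem card_abs_add_signedSum_lt_le {α : Type*} [Fintype α] [DecidableEq α]
    (hα : Fintype.card α = 8) (a : α → ℝ) {γ : ℝ} (hγ : 0 < γ) (ha : ∀ i, γ / 2 ≤ |a i|)
    (x : ℝ) :
    (Finset.univ.filter fun ε : α → Bool => |x + signedSum a ε| < γ).card ≤ 126 := by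
  let g : Finset α → ℝ := fun A => x + ∑ i, |a i| * (if i ∈ A then 1 else -1)
  have hg : ∀ A B : Finset α, A ⊆ B → A ≠ B → g A + γ ≤ g B := by
    intro A B hAB hne
    obtain ⟨j, hjB, hjA⟩ := Finset.exists_of_ssubset (hAB.ssubset_of_ne hne)
    have hle : ∑ i, (|a i| * (if i ∈ A then 1 else -1) + if i = j then γ else 0) ≤
        ∑ i, |a i| * (if i ∈ B then 1 else -1) := by
      refine Finset.sum_le_sum fun i _ => ?_
      have hai := ha i
      by_cases hij : i = j
      · subst hij
        simp only [hjA, hjB, if_true, if_false]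
        linarith
      · by_cases hiA : i ∈ A
        · simp [hij, hiA, hAB hiA]
        · by_cases hiB : i ∈ B <;> simp only [hij, hiA, hiB, if_true, if_false] <;> linarith
    rw [Finset.sum_add_distrib, Finset.sum_ite_eq' Finset.univ j] at hle
    simp only [Finset.mem_univ, if_true] at hle
    simp only [g]
    linarith
  have hanti : ∀ l : ℝ, IsAntichain (· ⊆ ·)
      ((Finset.univ.filter fun A => l ≤ g A ∧ g A < l + γ : Finset (Finset α)) :
        Set (Finset α)) := by
    intro l A hA B hB hne hAB
    simp only [Finset.coe_filter, Finset.mem_univ, true_and, Set.mem_ofPred_eq] at hA hB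
    linarith [hg A B hAB hne, hA.1, hB.2]
  have hdisj : Disjoint (Finset.univ.filter fun A => -γ ≤ g A ∧ g A < -γ + γ)
      (Finset.univ.filter fun A => 0 ≤ g A ∧ g A < 0 + γ) := by
    rw [Finset.disjoint_filter]
    intro A _ h1 h2
    linarith [h1.2, h2.1]
  refine le_trans ?_ (card_le_of_disjoint_antichains hα hdisj (hanti _) (hanti _))
  let pos : (α → Bool) → Finset α := fun ε => Finset.univ.filter fun i => ε i = true ↔ 0 ≤ a i
  have hpos : ∀ ε, x + signedSum a ε = g (pos ε) := by
    intro ε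
    simp only [g, signedSum, pos, Finset.mem_filter, Finset.mem_univ, true_and]
    congr 1
    refine Finset.sum_congr rfl fun i _ => ?_
    rcases le_or_gt 0 (a i) with h | h
    · simp [h, abs_of_nonneg h]
    · cases hε : ε i <;> simp [h.not_ge, abs_of_neg h]
  refine Finset.card_le_card_of_injOn pos ?_ ?_
  · intro ε hε
    simp only [Finset.coe_filter, Finset.mem_univ, true_and, Set.mem_ofPred_eq, hpos] at hε
    rw [abs_lt] at hε
    simp only [Finset.coe_union, Finset.coe_filter, Finset.mem_univ, true_and, Set.mem_union,
      Set.mem_ofPred_eq]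
    rcases lt_or_ge (g (pos ε)) 0 with h | h
    · exact Or.inl ⟨hε.1.le, by linarith⟩
    · exact Or.inr ⟨h, by linarith [hε.2]⟩
  · intro ε _ ε' _ h
    funext i
    have hi := congrArg (i ∈ ·) h
    simp only [pos, Finset.mem_filter, Finset.mem_univ, true_and, eq_iff_iff] at hi
    rw [Bool.eq_iff_iff]
    tauto

/-- If eight weights are at least `γ / 2` in absolute value, then `|signedSum b ε| < γ` for at most
half of the sign vectors: fix the other signs and split the remaining ones into two antichains. -/
theorem two_mul_card_abs_lt_le_of_eight_large {ι : Type*} [Fintype ι] [DecidableEq ι]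
    (b : ι → ℝ) {γ : ℝ} (hγ : 0 < γ) (T : Finset ι) (hT : T.card = 8)
    (hb : ∀ i ∈ T, γ / 2 ≤ |b i|) :
    2 * (Finset.univ.filter fun ε : ι → Bool => |signedSum b ε| < γ).card ≤
      2 ^ Fintype.card ι := by
  have hT' : Fintype.card {i // i ∈ T} = 8 := by rw [Fintype.card_coe, hT]
  have hcard : Fintype.card ι = 8 + Fintype.card {i // i ∉ T} := by
    rw [← hT', Fintype.card_subtype_compl, hT']
    have : 8 ≤ Fintype.card ι := hT ▸ Finset.card_le_univ T
    omega
  let e := Equiv.piEquivPiSubtypeProd (fun i => i ∈ T) (fun _ : ι => Bool)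
  have hsum : ∀ q, signedSum b (e.symm q) =
      signedSum (fun i : {i // i ∉ T} => b i) q.2 + signedSum (fun i : {i // i ∈ T} => b i) q.1 := by
    intro q
    rw [add_comm]
    unfold signedSum
    rw [← Fintype.sum_subtype_add_sum_subtype (fun i => i ∈ T)]
    congr 1 <;> refine Finset.sum_congr (by ext; simp) fun i _ => ?_ <;>
      simp [e, Equiv.piEquivPiSubtypeProd, i.2]
  rw [Finset.card_filter, ← e.symm.sum_comp, Fintype.sum_prod_type_right]
  simp only [hsum, ← Finset.card_filter]
  have hle := Finset.sum_le_card_nsmul Finset.univ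
    (fun g : {i // i ∉ T} → Bool => (Finset.univ.filter fun f : {i // i ∈ T} → Bool =>
      |signedSum (fun i : {i // i ∉ T} => b i) g + signedSum (fun i : {i // i ∈ T} => b i) f| <
        γ).card) 126
    (fun g _ => card_abs_add_signedSum_lt_le hT' _ hγ (fun i => hb i i.2) _)
  rw [Finset.card_univ, Fintype.card_fun, Fintype.card_bool, smul_eq_mul] at hle
  rw [hcard, pow_add]
  omega

theorem two_mul_card_abs_lt_le_of_le_abs {ι : Type*} [Fintype ι] [DecidableEq ι]
    (b : ι → ℝ) {γ : ℝ} (j : ι) (hj : γ ≤ |b j|) :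
    2 * (Finset.univ.filter fun ε : ι → Bool => |signedSum b ε| < γ).card ≤
      2 ^ Fintype.card ι := by
  let flip : (ι → Bool) → (ι → Bool) := fun ε => Function.update ε j (!ε j)
  have hflip : ∀ ε, |signedSum b ε - signedSum b (flip ε)| = 2 * |b j| := by
    intro ε
    unfold signedSum
    rw [← Finset.sum_sub_distrib, Finset.sum_eq_single j]
    · cases h : ε j <;> simp only [flip, Function.update_self, h, Bool.not_false, Bool.not_true,
        Bool.false_eq_true, if_true, if_false]
      · rw [show b j * -1 - b j * 1 = -(2 * b j) by ring, abs_neg, abs_mul, abs_two]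
      · rw [show b j * 1 - b j * -1 = 2 * b j by ring, abs_mul, abs_two]
    · intro i _ hij
      simp [flip, Function.update_of_ne hij]
    · simp
  have hinv : Function.Involutive flip := fun ε => by simp [flip]
  have hle := Finset.card_le_card_of_injOn
    (s := Finset.univ.filter fun ε : ι → Bool => |signedSum b ε| < γ)
    (t := Finset.univ.filter fun ε : ι → Bool => ¬ |signedSum b ε| < γ) flip
    (by
      intro ε hε
      simp only [Finset.coe_filter, Finset.mem_univ, true_and, Set.mem_ofPred_eq] at hε ⊢
      intro h
      linarith [hflip ε, abs_sub (signedSum b ε) (signedSum b (flip ε))])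
    hinv.injective.injOn
  have htot := Finset.card_filter_add_card_filter_not (s := (Finset.univ : Finset (ι → Bool)))
    (fun ε => |signedSum b ε| < γ)
  rw [Finset.card_univ, Fintype.card_fun, Fintype.card_bool] at htot
  omega

theorem signedSum_not {ι : Type*} [Fintype ι] (b : ι → ℝ) (ε : ι → Bool) :
    signedSum b (fun i => !ε i) = -signedSum b ε := by
  unfold signedSum
  rw [← Finset.sum_neg_distrib]
  refine Finset.sum_congr rfl fun i _ => ?_
  cases h : ε i <;> simp [h]

theorem card_filter_signedSum_neg {ι : Type*} [Fintype ι] [DecidableEq ι] (b : ι → ℝ)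
    (P : ℝ → Prop) [DecidablePred P] :
    (Finset.univ.filter fun ε : ι → Bool => P (-signedSum b ε)).card =
      (Finset.univ.filter fun ε : ι → Bool => P (signedSum b ε)).card := by
  have hinv : Function.Involutive fun (ε : ι → Bool) i => !ε i := fun ε => by simp
  simp only [Finset.card_filter, ← signedSum_not]
  exact (Equiv.sum_comp hinv.toPerm fun ε => if P (signedSum b ε) then 1 else 0)

/-- A Rademacher sum of variance at least `8.17 * γ ^ 2` is at least `γ` with probability at least
`1 / 4`, in counting form. -/
theorem two_pow_le_four_mul_card_le_signedSum {ι : Type*} [Fintype ι] [DecidableEq ι]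
    (b : ι → ℝ) {γ : ℝ} (hγ : 0 < γ) (hvar : 8.17 * γ ^ 2 ≤ ∑ i, b i ^ 2) :
    2 ^ Fintype.card ι ≤
      4 * (Finset.univ.filter fun ε : ι → Bool => γ ≤ signedSum b ε).card := by
  have hsmall : 2 * (Finset.univ.filter fun ε : ι → Bool => |signedSum b ε| < γ).card ≤
      2 ^ Fintype.card ι := by
    by_cases hj : ∃ j, γ ≤ |b j|
    · obtain ⟨j, hj⟩ := hj
      exact two_mul_card_abs_lt_le_of_le_abs b j hj
    · push Not at hj
      rcases le_or_gt (Finset.univ.filter fun i => γ / 2 ≤ |b i|).card 7 with h | h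
      · exact two_mul_card_abs_lt_le_of_few_large b hγ hj h hvar
      · obtain ⟨T, hTs, hT⟩ := Finset.exists_subset_card_eq (Nat.succ_le_of_lt h)
        exact two_mul_card_abs_lt_le_of_eight_large b hγ T hT
          fun i hi => (Finset.mem_filter.mp (hTs hi)).2
  have htot := Finset.card_filter_add_card_filter_not (s := (Finset.univ : Finset (ι → Bool)))
    (fun ε => |signedSum b ε| < γ)
  rw [Finset.card_univ, Fintype.card_fun, Fintype.card_bool] at htot
  have hunion : (Finset.univ.filter fun ε : ι → Bool => ¬ |signedSum b ε| < γ) ⊆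
      (Finset.univ.filter fun ε : ι → Bool => γ ≤ signedSum b ε) ∪
        (Finset.univ.filter fun ε : ι → Bool => γ ≤ -signedSum b ε) := by
    intro ε
    simp only [Finset.mem_filter, Finset.mem_univ, true_and, Finset.mem_union, not_lt]
    exact le_abs.mp
  have hcard := (Finset.card_le_card hunion).trans (Finset.card_union_le _ _)
  rw [card_filter_signedSum_neg b (fun x => γ ≤ x)] at hcard
  omega

theorem radMeasure_real_apply {m : ℕ} (b : Fin m → ℝ) (P : ℝ → Prop) [DecidablePred P]
    (hP : MeasurableSet {x | P x}) :
    (radMeasure m b).real {x | P x} =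
      (Finset.univ.filter fun ε : Fin m → Bool => P (signedSum b ε)).card / 2 ^ m := by
  have hpre : (fun ε : Fin m → Bool => ∑ i, b i * (if ε i then (1 : ℝ) else -1)) ⁻¹' {x | P x} =
      {ε | P (signedSum b ε)} := rfl
  rw [measureReal_def, radMeasure, Measure.map_apply (measurable_of_finite _) hP, hpre,
    PMF.toMeasure_uniformOfFintype_apply _ (Set.toFinite _).measurableSet, Fintype.card_fun,
    Fintype.card_bool, Fintype.card_fin,
    show Fintype.card {ε | P (signedSum b ε)} = _ from Fintype.card_subtype _]
  simp

instance isProbabilityMeasure_radMeasure (m : ℕ) (b : Fin m → ℝ) :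
    IsProbabilityMeasure (radMeasure m b) :=
  Measure.isProbabilityMeasure_map (measurable_of_finite _).aemeasurable

theorem radMeasure_real_Iic_neg {m : ℕ} (b : Fin m → ℝ) (c : ℝ) :
    (radMeasure m b).real (Set.Iic (-c)) = (radMeasure m b).real (Set.Ici c) := by
  have h1 := radMeasure_real_apply b (fun x => x ≤ -c) measurableSet_Iic
  have h2 := radMeasure_real_apply b (fun x => c ≤ x) measurableSet_Ici
  rw [Set.Iic_def] at h1
  rw [Set.Ici_def] at h2
  rw [h1, h2, ← card_filter_signedSum_neg b (fun x => c ≤ x)]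
  simp only [le_neg]

theorem one_sub_le_radMeasure_real_Ici_neg {m : ℕ} (b : Fin m → ℝ) (c : ℝ) :
    1 - (radMeasure m b).real (Set.Ici c) ≤ (radMeasure m b).real (Set.Ici (-c)) := by
  rw [← radMeasure_real_Iic_neg, ← probReal_compl_eq_one_sub measurableSet_Iic, Set.compl_Iic]
  exact measureReal_mono Set.Ioi_subset_Ici_self

theorem one_quarter_le_radMeasure_real_Ici {m : ℕ} (b : Fin m → ℝ) {γ : ℝ} (hγ : 0 < γ)
    (hvar : 8.17 * γ ^ 2 ≤ ∑ i, b i ^ 2) : 1 / 4 ≤ (radMeasure m b).real (Set.Ici γ) := by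
  have h := two_pow_le_four_mul_card_le_signedSum b hγ hvar
  have h2 := radMeasure_real_apply b (fun x => γ ≤ x) measurableSet_Ici
  rw [Set.Ici_def] at h2
  rw [h2, le_div_iff₀ (by positivity)]
  rw [Fintype.card_fin] at h
  have : (2 : ℝ) ^ m ≤
      4 * (Finset.univ.filter fun ε : Fin m → Bool => γ ≤ signedSum b ε).card := by
    exact_mod_cast h
  linarith

theorem large_variance_tail (Ω : Type*) [MeasurableSpace Ω]
    (μ : Measure Ω) [IsProbabilityMeasure μ]
    (Y Z : Ω → ℝ) (hY : Measurable Y) (hZ : Measurable Z)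
    (hind : IndepFun Y Z μ)
    (s γ d : ℝ) (hγ : 0 < γ) (hγd : γ < d / 2)
    (m : ℕ) (hm : 0 < m) (b : Fin m → ℝ)
    (hdist : Measure.map Z μ = radMeasure m b)
    (hvar : 8.17 * γ ^ 2 ≤ ∑ i, (b i) ^ 2)
    (p : ℤ → ℝ)
    (hp : ∀ r : ℤ, p r =
      (μ {ω | Y ω ∈ Set.Icc (s + (r : ℝ) * d - γ) (s + (r : ℝ) * d + γ)}).toReal)
    (t : ℝ) (ht : t = ∑' r : ℕ, p ((r : ℤ) + 2))
    (h1 : p (-1) ≥ t) (h2 : p 0 ≥ p 1) :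
    (μ {ω | Y ω + Z ω ≥ s}).toReal ≥ p 0 / 4 + 3 * p 1 / 4 + t := by
  let I : ℤ → Set ℝ := fun r => Set.Icc (s + (r : ℝ) * d - γ) (s + (r : ℝ) * d + γ)
  have hImeas : ∀ r, MeasurableSet (I r) := fun r => measurableSet_Icc
  have hIdisj : ∀ r r' : ℤ, r < r' → Disjoint (I r) (I r') := by
    intro r r' hr
    rw [Set.disjoint_left]
    intro y hy hy'
    have hr1 : (r : ℝ) + 1 ≤ r' := by exact_mod_cast hr
    have : ((r : ℝ) + 1) * d ≤ r' * d := by gcongr; linarith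
    linarith [hy.2, hy'.1]
  have hIpair : Pairwise (Function.onFun Disjoint I) := fun r r' hne =>
    (lt_or_gt_of_ne hne).elim (hIdisj r r') fun h => (hIdisj r' r h).symm
  let J : Set ℝ := ⋃ n : ℕ, I ((n : ℤ) + 2)
  have hJmeas : MeasurableSet J := MeasurableSet.iUnion fun n => hImeas _
  have hJ : ∀ y ∈ J, s + 2 * d - γ ≤ y := by
    intro y hy
    obtain ⟨n, hn⟩ := Set.mem_iUnion.mp hy
    have hn1 := hn.1
    push_cast at hn1
    have : 0 ≤ (n : ℝ) * d := mul_nonneg n.cast_nonneg (by linarith)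
    linarith
  have hp' : ∀ r, p r = μ.real (Y ⁻¹' I r) := hp
  have htJ : t = μ.real (Y ⁻¹' J) := by
    rw [ht, measureReal_def, Set.preimage_iUnion, measure_iUnion
      (fun n n' hne => (hIpair (by simpa using hne)).preimage Y) (fun n => hY (hImeas _)),
      ENNReal.tsum_toReal_eq (fun n => measure_ne_top _ _)]
    exact tsum_congr fun n => hp' _
  let q : ℝ → ℝ := fun c => (radMeasure m b).real (Set.Ici c)
  have hprod : ∀ (A : Set ℝ) (c : ℝ), MeasurableSet A →
      μ.real (Y ⁻¹' A ∩ Z ⁻¹' Set.Ici c) = μ.real (Y ⁻¹' A) * q c := by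
    intro A c hA
    simp only [q, measureReal_def]
    rw [hind.measure_inter_preimage_eq_mul _ _ hA measurableSet_Ici, ENNReal.toReal_mul, ← hdist,
      Measure.map_apply hZ measurableSet_Ici]
  let E : Set ℝ → ℝ → Set Ω := fun A c => Y ⁻¹' A ∩ Z ⁻¹' Set.Ici c
  have hEmeas : ∀ A c, MeasurableSet A → MeasurableSet (E A c) := fun A c hA =>
    (hY hA).inter (hZ measurableSet_Ici)
  have hEdisj : ∀ {A B : Set ℝ} (c c' : ℝ), Disjoint A B → Disjoint (E A c) (E B c') :=
    fun c c' h => (h.preimage Y).mono Set.inter_subset_left Set.inter_subset_left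
  have hIJ : ∀ r : ℤ, r < 2 → Disjoint (I r) J := fun r hr =>
    Set.disjoint_iUnion_right.mpr fun n => hIdisj _ _ (by omega)
  have hsub : E (I (-1)) (d + γ) ∪ (E (I 0) γ ∪ (E (I 1) (-(d - γ)) ∪ E J (-(2 * d - γ)))) ⊆
      {ω | Y ω + Z ω ≥ s} := by
    rintro ω (⟨hy, hz⟩ | ⟨hy, hz⟩ | ⟨hy, hz⟩ | ⟨hy, hz⟩) <;> change _ ≤ Z ω at hz <;>
      change s ≤ Y ω + Z ω
    · have := hy.1
      push_cast at this
      linarith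
    · have := hy.1
      push_cast at this
      linarith
    · have := hy.1
      push_cast at this
      linarith
    · linarith [hJ _ hy]
  have hmono := measureReal_mono (μ := μ) hsub
  rw [measureReal_union (by
        simp only [Set.disjoint_union_right]
        exact ⟨hEdisj _ _ (hIdisj _ _ (by norm_num)), hEdisj _ _ (hIdisj _ _ (by norm_num)),
          hEdisj _ _ (hIJ _ (by norm_num))⟩)
      ((hEmeas _ _ (hImeas _)).union ((hEmeas _ _ (hImeas _)).union (hEmeas _ _ hJmeas))),
    measureReal_union (by
        simp only [Set.disjoint_union_right]
        exact ⟨hEdisj _ _ (hIdisj _ _ (by norm_num)), hEdisj _ _ (hIJ _ (by norm_num))⟩)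
      ((hEmeas _ _ (hImeas _)).union (hEmeas _ _ hJmeas)),
    measureReal_union (hEdisj _ _ (hIJ _ (by norm_num))) (hEmeas _ _ hJmeas),
    hprod _ _ (hImeas _), hprod _ _ (hImeas _), hprod _ _ (hImeas _), hprod _ _ hJmeas,
    ← hp', ← hp', ← hp', ← htJ] at hmono
  have hq : ∀ c c', c ≤ c' → q c' ≤ q c := fun c c' h =>
    measureReal_mono (Set.Ici_subset_Ici.mpr h)
  have hq0 : 0 ≤ q (d + γ) := measureReal_nonneg
  have ht0 : 0 ≤ t := htJ ▸ measureReal_nonneg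
  have hp1 : 0 ≤ p 1 := hp' 1 ▸ measureReal_nonneg
  have hquarter : 1 / 4 ≤ q γ := one_quarter_le_radMeasure_real_Ici b hγ hvar
  have hfar : t ≤ p (-1) * q (d + γ) + t * q (-(2 * d - γ)) := by
    have e1 := one_sub_le_radMeasure_real_Ici_neg b (2 * d - γ)
    have e2 := hq (d + γ) (2 * d - γ) (by linarith)
    have e3 : t * 1 ≤ t * (q (d + γ) + q (-(2 * d - γ))) := by
      gcongr
      linarith
    nlinarith
  have hnear : p 0 / 4 + 3 * p 1 / 4 ≤ p 0 * q γ + p 1 * q (-(d - γ)) := by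
    have e1 := one_sub_le_radMeasure_real_Ici_neg b (d - γ)
    have e2 := hq γ (d - γ) (by linarith)
    have e3 : p 1 * (1 - q γ) ≤ p 1 * q (-(d - γ)) := by
      gcongr
      linarith
    nlinarith
  change _ ≤ μ.real {ω | Y ω + Z ω ≥ s}
  linarith
end

section
/- Let X = Σ_{i=1}^n a_i ε_i be a normalized finite Rademacher sum with a_1 ≥ a_2 ≥ ... ≥ a_n > 0, n ≥ 4, and suppose |a_i − 1/2| ≤ 0.005 for each 1 ≤ i ≤ 4. Then P(X ≥ 1) ≥ 7/64. -/
/-- Flip the `i`-th bit of a point of the discrete cube. -/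
def flipBit {n : ℕ} (i : Fin n) (e : Fin n → Bool) : Fin n → Bool :=
  Function.update e i (!e i)

/-- Flip all the bits of a point of the discrete cube. -/
def flipAll {n : ℕ} (e : Fin n → Bool) : Fin n → Bool := fun i => !e i

/-- The correlations of `f` with its one-bit flips, summed over all bits. -/
noncomputable def flipCorr (n : ℕ) (f : (Fin n → Bool) → ℝ) : ℝ :=
  ∑ i, ∑ e, f e * f (flipBit i e)

/-- The correlation of `f` with its composition with the antipodal map. -/
noncomputable def antiCorr (n : ℕ) (f : (Fin n → Bool) → ℝ) : ℝ :=
  ∑ e, f e * f (flipAll e)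

/-- The signed sum with weights `b` at a point of the discrete cube. -/
noncomputable def signSum {n : ℕ} (b : Fin n → ℝ) (e : Fin n → Bool) : ℝ :=
  ∑ i, b i * (if e i then (1 : ℝ) else -1)

lemma sum_cube_succ {n : ℕ} (f : (Fin (n + 1) → Bool) → ℝ) :
    ∑ e, f e = ∑ e : Fin n → Bool, f (Fin.cons true e) + ∑ e : Fin n → Bool, f (Fin.cons false e) := by
  rw [← (Fin.consEquiv (fun _ : Fin (n + 1) => Bool)).sum_comp, Fintype.sum_prod_type,
    Fintype.sum_bool]
  rfl

lemma flipBit_zero_cons {n : ℕ} (c : Bool) (e : Fin n → Bool) :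
    flipBit 0 (Fin.cons c e : Fin (n + 1) → Bool) = Fin.cons (!c) e := by
  simp [flipBit, Fin.update_cons_zero]

lemma flipBit_succ_cons {n : ℕ} (i : Fin n) (c : Bool) (e : Fin n → Bool) :
    flipBit i.succ (Fin.cons c e : Fin (n + 1) → Bool) = Fin.cons c (flipBit i e) := by
  simp [flipBit, Fin.cons_update]

lemma flipAll_cons {n : ℕ} (c : Bool) (e : Fin n → Bool) :
    flipAll (Fin.cons c e : Fin (n + 1) → Bool) = Fin.cons (!c) (flipAll e) := by
  funext i
  refine Fin.cases ?_ (fun j => ?_) i <;> simp [flipAll]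

lemma flipAll_involutive {n : ℕ} : Function.Involutive (flipAll (n := n)) := by
  intro e
  funext i
  simp [flipAll]

lemma sum_flipAll {n : ℕ} (f : (Fin n → Bool) → ℝ) : ∑ e, f (flipAll e) = ∑ e, f e :=
  Equiv.sum_comp (flipAll_involutive.toPerm flipAll) f

/-- Every function on the `(n+1)`-cube is `u + x v` in terms of its first coordinate `x`. -/
lemma exists_even_odd_parts {n : ℕ} (f : (Fin (n + 1) → Bool) → ℝ) :
    ∃ u v : (Fin n → Bool) → ℝ, (∀ e, f (Fin.cons true e) = u e + v e) ∧
      ∀ e, f (Fin.cons false e) = u e - v e :=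
  ⟨fun e => (f (Fin.cons true e) + f (Fin.cons false e)) / 2,
    fun e => (f (Fin.cons true e) - f (Fin.cons false e)) / 2,
    fun e => by ring, fun e => by ring⟩

section Decomposition

variable {n : ℕ} {f : (Fin (n + 1) → Bool) → ℝ} {u v : (Fin n → Bool) → ℝ}

lemma sum_of_parts (ht : ∀ e, f (Fin.cons true e) = u e + v e)
    (hf : ∀ e, f (Fin.cons false e) = u e - v e) : ∑ e, f e = 2 * ∑ e, u e := by
  rw [sum_cube_succ, ← Finset.sum_add_distrib, Finset.mul_sum]
  exact Finset.sum_congr rfl fun e _ => by rw [ht, hf]; ring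

lemma sum_sq_of_parts (ht : ∀ e, f (Fin.cons true e) = u e + v e)
    (hf : ∀ e, f (Fin.cons false e) = u e - v e) :
    ∑ e, f e ^ 2 = 2 * (∑ e, u e ^ 2 + ∑ e, v e ^ 2) := by
  rw [sum_cube_succ, ← Finset.sum_add_distrib, ← Finset.sum_add_distrib, Finset.mul_sum]
  exact Finset.sum_congr rfl fun e _ => by rw [ht, hf]; ring

lemma antiCorr_of_parts (ht : ∀ e, f (Fin.cons true e) = u e + v e)
    (hf : ∀ e, f (Fin.cons false e) = u e - v e) :
    antiCorr (n + 1) f = 2 * (antiCorr n u - antiCorr n v) := by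
  unfold antiCorr
  rw [sum_cube_succ, ← Finset.sum_add_distrib, ← Finset.sum_sub_distrib, Finset.mul_sum]
  refine Finset.sum_congr rfl fun e _ => ?_
  simp only [flipAll_cons, Bool.not_true, Bool.not_false, ht, hf]
  ring

lemma flipCorr_of_parts (ht : ∀ e, f (Fin.cons true e) = u e + v e)
    (hf : ∀ e, f (Fin.cons false e) = u e - v e) :
    flipCorr (n + 1) f =
      2 * (flipCorr n u + flipCorr n v) + 2 * (∑ e, u e ^ 2 - ∑ e, v e ^ 2) := by
  unfold flipCorr
  rw [Fin.sum_univ_succ, add_comm]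
  congr 1
  · rw [← Finset.sum_add_distrib, Finset.mul_sum]
    refine Finset.sum_congr rfl fun i _ => ?_
    rw [sum_cube_succ, ← Finset.sum_add_distrib, ← Finset.sum_add_distrib, Finset.mul_sum]
    refine Finset.sum_congr rfl fun e _ => ?_
    simp only [flipBit_succ_cons, ht, hf]
    ring
  · rw [sum_cube_succ, ← Finset.sum_add_distrib, ← Finset.sum_sub_distrib, Finset.mul_sum]
    refine Finset.sum_congr rfl fun e _ => ?_
    simp only [flipBit_zero_cons, Bool.not_true, Bool.not_false, ht, hf]
    ring

end Decomposition

lemma antiCorr_le_sum_sq (n : ℕ) (f : (Fin n → Bool) → ℝ) : antiCorr n f ≤ ∑ e, f e ^ 2 := by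
  have h : ∑ e, f (flipAll e) ^ 2 = ∑ e, f e ^ 2 := sum_flipAll fun e => f e ^ 2
  have h2 : 2 * antiCorr n f ≤ ∑ e, f e ^ 2 + ∑ e, f (flipAll e) ^ 2 := by
    rw [antiCorr, Finset.mul_sum, ← Finset.sum_add_distrib]
    exact Finset.sum_le_sum fun e _ => by nlinarith [sq_nonneg (f e - f (flipAll e))]
  linarith

/-- The Dirichlet form on the cube dominates the squared norm of the odd part. -/
lemma flipCorr_le (n : ℕ) (f : (Fin n → Bool) → ℝ) :
    flipCorr n f ≤ (n - 1) * ∑ e, f e ^ 2 + antiCorr n f := by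
  induction n with
  | zero =>
    have : ∀ e : Fin 0 → Bool, flipAll e = e := fun e => Subsingleton.elim _ _
    simp [flipCorr, antiCorr, this, sq]
  | succ n ih =>
    obtain ⟨u, v, ht, hf⟩ := exists_even_odd_parts f
    rw [flipCorr_of_parts ht hf, sum_sq_of_parts ht hf, antiCorr_of_parts ht hf]
    push_cast
    linarith [ih u, ih v, antiCorr_le_sum_sq n v]

/-- A Poincaré inequality on the cube which has spectral gap two on even functions. -/
lemma flipCorr_add_antiCorr_le (n : ℕ) (f : (Fin n → Bool) → ℝ) :
    flipCorr n f + antiCorr n f ≤ (n - 3) * ∑ e, f e ^ 2 + 4 * (∑ e, f e) ^ 2 / 2 ^ n := by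
  induction n with
  | zero =>
    have : ∀ e : Fin 0 → Bool, flipAll e = e := fun e => Subsingleton.elim _ _
    simp [flipCorr, antiCorr, this]
    linarith
  | succ n ih =>
    obtain ⟨u, v, ht, hf⟩ := exists_even_odd_parts f
    rw [flipCorr_of_parts ht hf, sum_sq_of_parts ht hf, antiCorr_of_parts ht hf,
      sum_of_parts ht hf]
    have h : 4 * (2 * ∑ e, u e) ^ 2 / 2 ^ (n + 1) = 2 * (4 * (∑ e, u e) ^ 2 / 2 ^ n) := by
      rw [pow_succ]
      field_simp
      ring
    rw [h]
    push_cast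
    linarith [ih u, flipCorr_le n v]

lemma signSum_flipAll {n : ℕ} (b : Fin n → ℝ) (e : Fin n → Bool) :
    signSum b (flipAll e) = -signSum b e := by
  unfold signSum
  rw [← Finset.sum_neg_distrib]
  refine Finset.sum_congr rfl fun i _ => ?_
  cases h : e i <;> simp [flipAll, h]

lemma signSum_flipBit {n : ℕ} (b : Fin n → ℝ) (i : Fin n) (e : Fin n → Bool) :
    signSum b (flipBit i e) = signSum b e - 2 * (b i * (if e i then (1 : ℝ) else -1)) := by
  unfold signSum
  rw [← Finset.add_sum_erase _ _ (Finset.mem_univ i),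
    ← Finset.add_sum_erase Finset.univ (fun j => b j * (if e j then (1 : ℝ) else -1))
      (Finset.mem_univ i)]
  have h : ∀ j ∈ Finset.univ.erase i, b j * (if flipBit i e j then (1 : ℝ) else -1) =
      b j * (if e j then (1 : ℝ) else -1) := by
    intro j hj
    rw [flipBit, Function.update_of_ne (Finset.ne_of_mem_erase hj)]
  rw [Finset.sum_congr rfl h]
  cases h : e i <;> simp [flipBit, h] <;> ring

lemma signSum_cons {n : ℕ} (b : Fin (n + 1) → ℝ) (c : Bool) (e : Fin n → Bool) :
    signSum b (Fin.cons c e) =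
      b 0 * (if c then (1 : ℝ) else -1) + signSum (fun i => b i.succ) e := by
  simp [signSum, Fin.sum_univ_succ]

lemma sum_signSum_sq (n : ℕ) (b : Fin n → ℝ) :
    ∑ e, signSum b e ^ 2 = 2 ^ n * ∑ i, b i ^ 2 := by
  induction n with
  | zero => simp [signSum]
  | succ n ih =>
    rw [sum_sq_of_parts (u := signSum fun i => b i.succ) (v := fun _ => b 0)
      (fun e => by rw [signSum_cons]; simp; ring) (fun e => by rw [signSum_cons]; simp; ring),
      ih, Fin.sum_univ_succ]
    simp
    ring

/-- The Khintchine inequality between the first and second moments, with its sharp constant. -/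
lemma sum_signSum_sq_le (n : ℕ) (b : Fin n → ℝ) :
    ∑ e, signSum b e ^ 2 ≤ 2 * (∑ e, |signSum b e|) ^ 2 / 2 ^ n := by
  have key := flipCorr_add_antiCorr_le n fun e => |signSum b e|
  have hA : antiCorr n (fun e => |signSum b e|) = ∑ e, signSum b e ^ 2 := by
    refine Finset.sum_congr rfl fun e _ => ?_
    simp only [signSum_flipAll, abs_neg, abs_mul_abs_self, sq]
  have hT : (n - 2) * ∑ e, signSum b e ^ 2 ≤ flipCorr n fun e => |signSum b e| := by
    rw [flipCorr, Finset.sum_comm, Finset.mul_sum]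
    refine Finset.sum_le_sum fun e _ => ?_
    rw [← Finset.mul_sum]
    have h1 : |∑ i, signSum b (flipBit i e)| ≤ ∑ i, |signSum b (flipBit i e)| :=
      Finset.abs_sum_le_sum_abs _ _
    have h2 : ∑ i, signSum b (flipBit i e) = (n - 2) * signSum b e := by
      simp only [signSum_flipBit, Finset.sum_sub_distrib, ← Finset.mul_sum]
      simp [signSum]
      ring
    rw [h2, abs_mul] at h1
    calc (n - 2) * signSum b e ^ 2 ≤ |(n - 2 : ℝ)| * signSum b e ^ 2 := by
          gcongr
          exact le_abs_self _
      _ = |signSum b e| * (|(n - 2 : ℝ)| * |signSum b e|) := by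
          rw [← sq_abs (signSum b e)]
          ring
      _ ≤ _ := by gcongr
  simp only [sq_abs] at key
  have h : 4 * (∑ e, |signSum b e|) ^ 2 / 2 ^ n = 2 * (2 * (∑ e, |signSum b e|) ^ 2 / 2 ^ n) := by
    ring
  linarith

open Classical in
lemma radProb_eq_sum {n : ℕ} (b : Fin n → ℝ) (p : ℝ → Prop) :
    radProb b p = (∑ e, if p (signSum b e) then (1 : ℝ) else 0) / 2 ^ n := by
  unfold radProb
  rw [Finset.sum_boole, Nat.card_eq_fintype_card, Fintype.card_fin, Fintype.card_ofFinset]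
  simp [signSum]

lemma radProb_nonneg {n : ℕ} (b : Fin n → ℝ) (p : ℝ → Prop) : 0 ≤ radProb b p := by
  unfold radProb
  positivity

lemma radProb_mono {n : ℕ} (b : Fin n → ℝ) {p q : ℝ → Prop} (h : ∀ x, p x → q x) :
    radProb b p ≤ radProb b q := by
  classical
  rw [radProb_eq_sum, radProb_eq_sum]
  gcongr with e
  split_ifs with h1 h2 <;> first | exact (h2 (h _ h1)).elim | norm_num

lemma radProb_ge_succ {n : ℕ} (b : Fin (n + 1) → ℝ) (t : ℝ) :
    radProb b (fun x => x ≥ t) = (radProb (fun i : Fin n => b i.succ) (fun x => x ≥ t - b 0) +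
      radProb (fun i : Fin n => b i.succ) (fun x => x ≥ t + b 0)) / 2 := by
  classical
  have h1 : ∀ e : Fin n → Bool, (if signSum b (Fin.cons true e) ≥ t then (1 : ℝ) else 0) =
      if signSum (fun i => b i.succ) e ≥ t - b 0 then 1 else 0 := fun e => by
    refine if_congr ?_ rfl rfl
    rw [signSum_cons, if_pos rfl]
    constructor <;> intro h <;> linarith
  have h2 : ∀ e : Fin n → Bool, (if signSum b (Fin.cons false e) ≥ t then (1 : ℝ) else 0) =
      if signSum (fun i => b i.succ) e ≥ t + b 0 then 1 else 0 := fun e => by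
    refine if_congr ?_ rfl rfl
    rw [signSum_cons, if_neg Bool.false_ne_true]
    constructor <;> intro h <;> linarith
  rw [radProb_eq_sum, radProb_eq_sum, radProb_eq_sum, sum_cube_succ, pow_succ]
  simp only [h1, h2]
  field_simp

open Classical in
lemma radProb_ge_eq_sum_neg {n : ℕ} (b : Fin n → ℝ) (t : ℝ) :
    radProb b (fun x => x ≥ t) = (∑ e, if -signSum b e ≥ t then (1 : ℝ) else 0) / 2 ^ n := by
  rw [radProb_eq_sum, ← sum_flipAll]
  simp only [signSum_flipAll]

lemma sum_cube_const (n : ℕ) (c : ℝ) : ∑ _e : Fin n → Bool, c = 2 ^ n * c := by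
  simp

lemma one_le_radProb_neg_add {n : ℕ} (b : Fin n → ℝ) (t : ℝ) :
    1 ≤ radProb b (fun x => x ≥ -t) + radProb b (fun x => x ≥ t) := by
  classical
  rw [radProb_ge_eq_sum_neg b (-t), radProb_eq_sum, ← add_div, ← Finset.sum_add_distrib,
    le_div_iff₀ (by positivity), one_mul, ← mul_one (2 ^ n), ← sum_cube_const]
  refine Finset.sum_le_sum fun e _ => ?_
  split_ifs <;> first | (exfalso; linarith) | norm_num

/-- Chebyshev's inequality. -/
lemma radProb_ge_mul_sq_le {n : ℕ} (b : Fin n → ℝ) {t : ℝ} (ht : 0 ≤ t) :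
    radProb b (fun x => x ≥ t) * t ^ 2 ≤ ∑ i, b i ^ 2 := by
  classical
  rw [radProb_eq_sum, div_mul_eq_mul_div, div_le_iff₀ (by positivity), mul_comm (∑ i, b i ^ 2),
    ← sum_signSum_sq, Finset.sum_mul]
  refine Finset.sum_le_sum fun e _ => ?_
  split_ifs with h
  · rw [one_mul]
    gcongr
  · rw [zero_mul]
    positivity

/-- A Paley–Zygmund type lower bound for the tail of a Rademacher sum. -/
lemma le_radProb_ge {n : ℕ} (b : Fin n → ℝ) {s t : ℝ} (hs : 0 < s)
    (hb : ∑ i, b i ^ 2 = 2 * s ^ 2) (ht : 0 < t) :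
    1 / 4 - t / (2 * s) ≤ radProb b (fun x => x ≥ t) := by
  classical
  have hN : (0 : ℝ) < 2 ^ n := by positivity
  have hK := sum_signSum_sq_le n b
  have h2 := sum_signSum_sq n b
  rw [hb] at h2
  have hM : 2 ^ n * s ≤ ∑ e, |signSum b e| := by
    rw [h2, le_div_iff₀ hN] at hK
    refine le_of_sq_le_sq ?_ (Finset.sum_nonneg fun e _ => abs_nonneg _)
    nlinarith
  have hsum : (∑ e, |signSum b e|) ≤ ∑ e, (t + signSum b e ^ 2 / (4 * s) +
      s * ((if signSum b e ≥ t then (1 : ℝ) else 0) +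
        (if -signSum b e ≥ t then (1 : ℝ) else 0))) := by
    refine Finset.sum_le_sum fun e _ => ?_
    generalize signSum b e = r
    have hr : |r| ≤ r ^ 2 / (4 * s) + s := by
      rw [← sq_abs, div_add' _ _ _ (by positivity), le_div_iff₀ (by positivity)]
      nlinarith [sq_nonneg (|r| - 2 * s)]
    have hr0 : 0 ≤ r ^ 2 / (4 * s) := by positivity
    split_ifs with h1 h2 h2
    · linarith
    · linarith
    · linarith
    · have : |r| ≤ t := abs_le.2 ⟨by linarith, by linarith⟩
      linarith
  have hg := radProb_eq_sum b (fun x => x ≥ t)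
  have hg' := radProb_ge_eq_sum_neg b t
  rw [eq_div_iff hN.ne'] at hg hg'
  rw [Finset.sum_add_distrib, Finset.sum_add_distrib, ← Finset.sum_div, ← Finset.mul_sum,
    Finset.sum_add_distrib, ← hg, ← hg', h2, sum_cube_const] at hsum
  set g := radProb b (fun x => x ≥ t)
  have h3 : 2 ^ n * s ≤ 2 ^ n * (t + s / 2 + 2 * s * g) := by
    have : 2 ^ n * (2 * s ^ 2) / (4 * s) = 2 ^ n * (s / 2) := by
      field_simp
      ring
    rw [this] at hsum
    linarith
  have h4 := le_of_mul_le_mul_left h3 hN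
  rw [sub_le_iff_le_add, div_le_iff₀ (by norm_num)]
  have h5 : t / (2 * s) * (2 * s) = t := by field_simp
  nlinarith

/-- The contribution of the sign patterns with exactly one minus sign among four weights
`1 / 2 + dᵢ`, given a remainder of variance `v` with tail function `g`. -/
lemma one_minus_tail_sum_ge {g : ℝ → ℝ} {v X d1 d2 d3 d4 : ℝ} (h12 : d2 ≤ d1) (h23 : d3 ≤ d2)
    (h34 : d4 ≤ d3) (hX : X = -(d1 + d2 + d3 + d4)) (hX2 : X ≤ 0.02)
    (hv : v = X - (d1 ^ 2 + d2 ^ 2 + d3 ^ 2 + d4 ^ 2)) (hg0 : ∀ t, 0 ≤ g t)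
    (hanti : ∀ s t, s ≤ t → g t ≤ g s) (hsymm : ∀ t, 1 ≤ g (-t) + g t)
    (hpz : ∀ s t, 0 < s → v = 2 * s ^ 2 → 0 < t → 1 / 4 - t / (2 * s) ≤ g t) :
    0.771 ≤ g (X + 2 * d4) + g (X + 2 * d3) + g (X + 2 * d2) + g (X + 2 * d1) := by
  have hhalf : ∀ t, t ≤ 0 → 1 / 2 ≤ g t := fun t ht => by
    have h := hsymm 0
    rw [neg_zero] at h
    linarith [hanti t 0 ht]
  have p1 := hg0 (X + 2 * d1)
  have p2 := hg0 (X + 2 * d2)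
  have p3 := hg0 (X + 2 * d3)
  have p4 := hg0 (X + 2 * d4)
  rcases le_or_gt (X + 2 * d3) 0 with h3 | h3
  · linarith [hhalf _ h3, hhalf (X + 2 * d4) (by linarith)]
  rcases le_or_gt (X + 2 * d3) (-(X + 2 * d4)) with h4 | h4
  · have h := hsymm (-(X + 2 * d4))
    rw [neg_neg] at h
    linarith [hanti _ _ h4]
  have hX0 : 0 < X := by linarith
  have q1 : d1 ^ 2 ≤ (X / 2) ^ 2 := sq_le_sq' (by linarith) (by linarith)
  have q2 : d2 ^ 2 ≤ (X / 2) ^ 2 := sq_le_sq' (by linarith) (by linarith)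
  have q3 : d3 ^ 2 ≤ (X / 2) ^ 2 := sq_le_sq' (by linarith) (by linarith)
  have q4 : d4 ^ 2 ≤ X ^ 2 := sq_le_sq' (by linarith) (by linarith)
  have hXX : X ^ 2 ≤ 0.02 * X := by
    rw [sq]
    exact mul_le_mul_of_nonneg_right hX2 hX0.le
  have hvlow : 0.965 * X ≤ v := by
    rw [div_pow] at q1 q2 q3
    linarith
  obtain ⟨s, hs, hvs⟩ : ∃ s, 0 < s ∧ v = 2 * s ^ 2 :=
    ⟨√(v / 2), Real.sqrt_pos.2 (by linarith), by rw [Real.sq_sqrt (by linarith)]; ring⟩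
  have hXs : X / s ≤ 0.22 := by
    rw [div_le_iff₀ hs]
    refine le_of_sq_le_sq ?_ (by positivity)
    rw [mul_pow]
    linarith
  have hpz' : ∀ t, 0 < t → 1 / 4 - t / (2 * s) ≤ g t := fun t ht => hpz s t hs hvs ht
  have r1 := hpz' (X + 2 * d1) (by linarith)
  have r2 := hpz' (X + 2 * d2) (by linarith)
  have r3 := hpz' (X + 2 * d3) h3
  have hmul : ∀ t, t / (2 * s) * (2 * s) = t := fun t => div_mul_cancel₀ t (by positivity)
  rcases le_or_gt (X + 2 * d4) 0 with h5 | h5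
  · have : (X + 2 * d2) / (2 * s) + (X + 2 * d3) / (2 * s) ≤ X / s := by
      rw [← add_div, ← mul_div_mul_left X s two_ne_zero]
      gcongr
      linarith
    linarith [hhalf _ h5]
  · have : (X + 2 * d1) / (2 * s) + (X + 2 * d2) / (2 * s) + (X + 2 * d3) / (2 * s) +
        (X + 2 * d4) / (2 * s) = X / s := by
      rw [← add_div, ← add_div, ← add_div, ← mul_div_mul_left X s two_ne_zero]
      congr 1
      linarith
    linarith [hpz' _ h5]

/-- Four weights near `1 / 2` together with a remainder of variance `v` with tail function `g`. -/
lemma tail_sum_ge {g : ℝ → ℝ} {v w x y z : ℝ} (hwx : x ≤ w) (hxy : y ≤ x) (hyz : z ≤ y)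
    (hw : |w - 1 / 2| ≤ 0.005) (hx : |x - 1 / 2| ≤ 0.005) (hy : |y - 1 / 2| ≤ 0.005)
    (hz : |z - 1 / 2| ≤ 0.005) (hv : w ^ 2 + x ^ 2 + y ^ 2 + z ^ 2 + v = 1)
    (hg0 : ∀ t, 0 ≤ g t) (hanti : ∀ s t, s ≤ t → g t ≤ g s) (hsymm : ∀ t, 1 ≤ g (-t) + g t)
    (hcheb : ∀ t, 0 ≤ t → g t * t ^ 2 ≤ v)
    (hpz : ∀ s t, 0 < s → v = 2 * s ^ 2 → 0 < t → 1 / 4 - t / (2 * s) ≤ g t) :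
    7 / 4 ≤ g (1 - w - x - y - z) + g (1 - w - x - y + z) + g (1 - w - x + y - z) +
      g (1 - w + x - y - z) + g (1 + w - x - y - z) := by
  rw [abs_le] at hw hx hy hz
  have hmain : 0.979 ≤ g (1 - w - x - y - z) := by
    have h1 := hanti (1 - w - x - y - z) (-0.98) (by linarith)
    have h2 := hsymm 0.98
    have h3 := hcheb 0.98 (by norm_num)
    have h5 : ∀ c : ℝ, -0.005 ≤ c - 1 / 2 → 0.245025 ≤ c ^ 2 := fun c hc => by nlinarith
    have h4 : v ≤ 0.0199 := by linarith [h5 w hw.1, h5 x hx.1, h5 y hy.1, h5 z hz.1]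
    linarith
  have h := one_minus_tail_sum_ge (g := g) (v := v) (X := 2 - (w + x + y + z)) (d1 := w - 1 / 2)
    (d2 := x - 1 / 2) (d3 := y - 1 / 2) (d4 := z - 1 / 2) (by linarith) (by linarith)
    (by linarith) (by ring) (by linarith) (by linarith) hg0 hanti hsymm hpz
  rw [show 2 - (w + x + y + z) + 2 * (z - 1 / 2) = 1 - w - x - y + z by ring,
    show 2 - (w + x + y + z) + 2 * (y - 1 / 2) = 1 - w - x + y - z by ring,
    show 2 - (w + x + y + z) + 2 * (x - 1 / 2) = 1 - w + x - y - z by ring,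
    show 2 - (w + x + y + z) + 2 * (w - 1 / 2) = 1 + w - x - y - z by ring] at h
  linarith

theorem caseB_prob_ge (n : ℕ) (hn : 4 ≤ n) (a : Fin n → ℝ)
    (hmono : ∀ i j : Fin n, i ≤ j → a j ≤ a i) (hpos : ∀ i, 0 < a i)
    (hnorm : ∑ i, (a i) ^ 2 = 1)
    (hclose : ∀ i : Fin n, (i : ℕ) < 4 → |a i - 1 / 2| ≤ 0.005) :
    radProb a (fun x => x ≥ 1) ≥ 7 / 64 := by
  obtain ⟨m, rfl⟩ : ∃ m, n = m + 1 + 1 + 1 + 1 := ⟨n - 4, by omega⟩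
  set b : Fin m → ℝ := fun i => a i.succ.succ.succ.succ with hb
  simp only [Fin.sum_univ_succ (n := m + 1 + 1 + 1), Fin.sum_univ_succ (n := m + 1 + 1),
    Fin.sum_univ_succ (n := m + 1), Fin.sum_univ_succ (n := m)] at hnorm
  have key := tail_sum_ge (g := fun t => radProb b (fun x => x ≥ t)) (v := ∑ i, b i ^ 2)
    (hmono 0 (Fin.succ 0) (Fin.zero_le _))
    (hmono (Fin.succ 0) (Fin.succ (Fin.succ 0)) (Fin.succ_le_succ_iff.2 (Fin.zero_le _)))
    (hmono (Fin.succ (Fin.succ 0)) (Fin.succ (Fin.succ (Fin.succ 0)))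
      (Fin.succ_le_succ_iff.2 (Fin.succ_le_succ_iff.2 (Fin.zero_le _))))
    (hclose _ (by simp only [Fin.val_zero]; norm_num))
    (hclose _ (by simp only [Fin.val_succ, Fin.val_zero]; norm_num))
    (hclose _ (by simp only [Fin.val_succ, Fin.val_zero]; norm_num))
    (hclose _ (by simp only [Fin.val_succ, Fin.val_zero]; norm_num))
    (by rw [← hnorm, hb]; ring) (fun t => radProb_nonneg b _)
    (fun s t hst => radProb_mono b fun x hx => le_trans hst hx) (one_le_radProb_neg_add b)
    (fun t ht => radProb_ge_mul_sq_le b ht) (fun s t hs hv ht => le_radProb_ge b hs hv ht)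
  have hnn : ∀ t, 0 ≤ radProb b (fun x => x ≥ t) := fun t => radProb_nonneg b _
  rw [radProb_ge_succ]
  simp only [radProb_ge_succ (n := m + 1 + 1), radProb_ge_succ (n := m + 1),
    radProb_ge_succ (n := m)]
  rw [← hb]
  set a0 := a 0
  set a1 := a (Fin.succ 0)
  set a2 := a (Fin.succ (Fin.succ 0))
  set a3 := a (Fin.succ (Fin.succ (Fin.succ 0)))
  linarith [hnn (1 - a0 - a1 + a2 + a3), hnn (1 - a0 + a1 - a2 + a3), hnn (1 - a0 + a1 + a2 - a3),
    hnn (1 - a0 + a1 + a2 + a3), hnn (1 + a0 - a1 - a2 + a3), hnn (1 + a0 - a1 + a2 - a3),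
    hnn (1 + a0 - a1 + a2 + a3), hnn (1 + a0 + a1 - a2 - a3), hnn (1 + a0 + a1 - a2 + a3),
    hnn (1 + a0 + a1 + a2 - a3), hnn (1 + a0 + a1 + a2 + a3)]
end
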